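/- arXiv:1505.03132 — 4 statements merged into one kernel-verified Lean document; each statement's English description precedes it below -/
import Mathlib

section
/- Let A be an m×n integer matrix of rank n and b an integer vector in ℤ^m such that P(A,b) = {x ∈ ℝ^n : Ax ≤ b} is a nonempty bounded polytope. If the width w(P(A,b)) is strictly greater than (Δ_lcm(A) − 1)·(Δ(A)/Δ_gcd(A))·(n+1), then P(A,b) contains at least n+1 integer points, i.e. |P(A,b) ∩ ℤ^n| ≥ n+1. -/
open Matrix

/-- The polyhedron `P(A,b) = {x ∈ ℝ^n : A x ≤ b}` of an integer matrix `A` and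
integer right-hand side `b`. -/
def poly {m n : ℕ} (A : Matrix (Fin m) (Fin n) ℤ) (b : Fin m → ℤ) : Set (Fin n → ℝ) :=
  {x | ∀ i, ((A.map (Int.cast : ℤ → ℝ)).mulVec x) i ≤ (b i : ℝ)}

/-- The lattice width of a set `P ⊆ ℝ^n`: the minimum (infimum) over nonzero integer
vectors `c` of `sup_{x ∈ P} c⋅x − inf_{x ∈ P} c⋅x`. -/
noncomputable def width {n : ℕ} (P : Set (Fin n → ℝ)) : ℝ :=
  sInf {w : ℝ | ∃ c : Fin n → ℤ, c ≠ 0 ∧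
    w = sSup ((fun x : Fin n → ℝ => ∑ i, (c i : ℝ) * x i) '' P)
        - sInf ((fun x : Fin n → ℝ => ∑ i, (c i : ℝ) * x i) '' P)}

/-- `Δ(A)`: the maximum absolute value of the determinant of an `n × n` submatrix of `A`
(an `n × n` submatrix is obtained by selecting `n` pairwise distinct rows). -/
def maxDet {m n : ℕ} (A : Matrix (Fin m) (Fin n) ℤ) : ℕ :=
  (Finset.univ.filter fun f : Fin n → Fin m => Function.Injective f).sup
    fun f => ((A.submatrix f id).det).natAbs

/-- The set of nonzero absolute values of determinants of `n × n` submatrices of `A`. -/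
def detVals {m n : ℕ} (A : Matrix (Fin m) (Fin n) ℤ) : Finset ℕ :=
  ((Finset.univ.filter fun f : Fin n → Fin m => Function.Injective f).image
    fun f => ((A.submatrix f id).det).natAbs).erase 0

/-- `Δ_lcm(A)`: least common multiple of the nonzero absolute values of the determinants
of `n × n` submatrices of `A`. -/
def lcmDet {m n : ℕ} (A : Matrix (Fin m) (Fin n) ℤ) : ℕ := (detVals A).lcm id

/-- `Δ_gcd(A)`: greatest common divisor of the nonzero absolute values of the determinants
of `n × n` submatrices of `A`. -/
def gcdDet {m n : ℕ} (A : Matrix (Fin m) (Fin n) ℤ) : ℕ := (detVals A).gcd id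

/-- `δ(A)`: the minimum absolute value of the determinant of an `n × n` submatrix of `A`. -/
noncomputable def minDet {m n : ℕ} (A : Matrix (Fin m) (Fin n) ℤ) : ℕ :=
  sInf {d : ℕ | ∃ f : Fin n → Fin m, Function.Injective f ∧ ((A.submatrix f id).det).natAbs = d}

theorem LinearMap.apply_eq_dotProduct_single {ι : Type*} [Fintype ι] [DecidableEq ι]
    (f : (ι → ℝ) →ₗ[ℝ] ℝ) (w : ι → ℝ) : f w = w ⬝ᵥ fun i => f (Pi.single i 1) := by
  have hs : ∀ i : ι, (fun j => if i = j then (1 : ℝ) else 0) = Pi.single i 1 := fun i => by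
    ext j
    simp [Pi.single_apply, eq_comm]
  simp [LinearMap.pi_apply_eq_sum_univ f w, dotProduct, hs]

theorem exists_nonneg_vecMul_eq_zero_of_not_lt {ι : Type*} [Fintype ι] {n : ℕ}
    (R : Matrix ι (Fin n) ℝ) (c : ι → ℝ) (h : ¬ ∃ x, ∀ i, (R *ᵥ x) i < c i) :
    ∃ y : ι → ℝ, (∀ i, 0 ≤ y i) ∧ y ≠ 0 ∧ y ᵥ* R = 0 ∧ y ⬝ᵥ c ≤ 0 := by
  classical
  have hO : IsOpen (Set.univ.pi fun _ : ι => Set.Ioi (0 : ℝ)) :=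
    isOpen_set_pi Set.finite_univ fun _ _ => isOpen_Ioi
  have hOc : Convex ℝ (Set.univ.pi fun _ : ι => Set.Ioi (0 : ℝ)) :=
    convex_pi fun _ _ => convex_Ioi 0
  have hKc : Convex ℝ (Set.range fun x => c - R *ᵥ x) := by
    rintro _ ⟨x, rfl⟩ _ ⟨x', rfl⟩ s t _ _ hst
    refine ⟨s • x + t • x', ?_⟩
    ext i
    have : c i = (s + t) * c i := by rw [hst, one_mul]
    simp only [mulVec_add, mulVec_smul, Pi.sub_apply, Pi.add_apply, Pi.smul_apply, smul_eq_mul]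
    linear_combination this
  have hdisj : Disjoint (Set.univ.pi fun _ : ι => Set.Ioi (0 : ℝ))
      (Set.range fun x => c - R *ᵥ x) := by
    rw [Set.disjoint_left]
    rintro _ hx ⟨x, rfl⟩
    exact h ⟨x, fun i => by simpa using hx i trivial⟩
  obtain ⟨f, u, hfO, hfK⟩ := geometric_hahn_banach_open hOc hO hKc hdisj
  have hle : ∀ a : ι → ℝ, (∀ i, 0 ≤ a i) → f a ≤ u := by
    intro a ha
    have hcl : closure (Set.univ.pi fun _ : ι => Set.Ioi (0 : ℝ)) ⊆ {a | f a ≤ u} :=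
      closure_minimal (fun a ha => (hfO a ha).le) (isClosed_le f.continuous continuous_const)
    refine hcl ?_
    rw [closure_pi_set]
    intro i _
    simpa using ha i
  have hu : 0 ≤ u := by simpa using hle 0 fun _ => le_rfl
  set y : ι → ℝ := fun i => -f (Pi.single i 1) with hy
  have hf : ∀ w, f w = -(y ⬝ᵥ w) := by
    intro w
    have := f.toLinearMap.apply_eq_dotProduct_single w
    rw [dotProduct_comm]
    simpa [dotProduct, hy] using this
  have hK : ∀ x, y ⬝ᵥ c - (y ᵥ* R) ⬝ᵥ x ≤ -u := by
    intro x
    have := hfK _ ⟨x, rfl⟩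
    simp only [hf, dotProduct_sub, dotProduct_mulVec] at this
    linarith
  refine ⟨y, ?_, ?_, ?_, ?_⟩
  · intro i
    by_contra! hi
    have hpos : 0 < f (Pi.single i 1) := by simpa [hy] using hi
    have := hle (((u + 1) / f (Pi.single i 1)) • Pi.single i 1) fun j => by
      have : (0 : ℝ) ≤ (Pi.single i 1 : ι → ℝ) j := by
        rw [Pi.single_apply]; split_ifs <;> norm_num
      simp only [Pi.smul_apply, smul_eq_mul]
      positivity
    rw [map_smul, smul_eq_mul, div_mul_cancel₀ _ hpos.ne'] at this
    linarith
  · intro h0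
    have h1 := hfO (fun _ => 1) fun i _ => by simp
    have h2 := hK 0
    simp only [hf, h0, zero_dotProduct, zero_vecMul] at h1 h2
    linarith
  · by_contra hz
    have hq : 0 < (y ᵥ* R) ⬝ᵥ (y ᵥ* R) := by
      refine lt_of_le_of_ne (Finset.sum_nonneg fun i _ => mul_self_nonneg _) fun h0 => hz ?_
      exact dotProduct_self_eq_zero.1 h0.symm
    have := hK (((y ⬝ᵥ c - 1) / ((y ᵥ* R) ⬝ᵥ (y ᵥ* R))) • (y ᵥ* R))
    rw [dotProduct_smul, smul_eq_mul, div_mul_cancel₀ _ hq.ne'] at this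
    linarith
  · have := hK 0
    simp only [dotProduct_zero] at this
    linarith

theorem exists_nonneg_linearIndepOn_of_not_lt {ι : Type*} [Fintype ι] {n : ℕ}
    (R : Matrix ι (Fin n) ℝ) (c : ι → ℝ) (h : ¬ ∃ x, ∀ i, (R *ᵥ x) i < c i) :
    ∃ y : ι → ℝ, (∀ i, 0 ≤ y i) ∧ y ≠ 0 ∧ y ᵥ* R = 0 ∧ y ⬝ᵥ c ≤ 0 ∧
      ∀ k, y k ≠ 0 → LinearIndepOn ℝ R.row {i | y i ≠ 0 ∧ i ≠ k} := by
  classical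
  obtain ⟨y, ⟨hy0, hyne, hyR, hyc⟩, hmin⟩ := exists_minimalFor_of_wellFoundedLT
    (fun y : ι → ℝ => (∀ i, 0 ≤ y i) ∧ y ≠ 0 ∧ y ᵥ* R = 0 ∧ y ⬝ᵥ c ≤ 0)
    (fun y => Finset.univ.filter fun i => y i ≠ 0)
    (exists_nonneg_vecMul_eq_zero_of_not_lt R c h)
  refine ⟨y, hy0, hyne, hyR, hyc, fun k hk => ?_⟩
  by_contra hdep
  have hsmaller : ∀ y' : ι → ℝ, (∀ i, 0 ≤ y' i) → y' ≠ 0 → y' ᵥ* R = 0 → y' ⬝ᵥ c ≤ 0 →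
      (∀ i, y i = 0 → y' i = 0) → ∀ i, y' i = 0 → y i = 0 := by
    intro y' h1 h2 h3 h4 h5 i hi
    have := hmin (j := y') ⟨h1, h2, h3, h4⟩ fun j hj => by
      simp only [Finset.mem_filter, Finset.mem_univ, true_and] at hj ⊢
      exact mt (h5 j) hj
    by_contra hne
    simpa [hi] using this (Finset.mem_filter.2 ⟨Finset.mem_univ i, hne⟩)
  obtain ⟨z, hzR, hzc, hzne, hzsupp⟩ : ∃ z : ι → ℝ, z ᵥ* R = 0 ∧ z ⬝ᵥ c ≤ 0 ∧ z ≠ 0 ∧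
      ∀ i, z i ≠ 0 → y i ≠ 0 ∧ i ≠ k := by
    obtain ⟨z, hzR, hzne, hzsupp⟩ : ∃ z : ι → ℝ, z ᵥ* R = 0 ∧ z ≠ 0 ∧
        ∀ i, z i ≠ 0 → y i ≠ 0 ∧ i ≠ k := by
      rw [← Finset.coe_filter_univ, linearIndepOn_finset_iff] at hdep
      push Not at hdep
      obtain ⟨g, hg, i, hi, hgi⟩ := hdep
      refine ⟨fun j => if y j ≠ 0 ∧ j ≠ k then g j else 0, ?_, ?_, ?_⟩
      · rw [vecMul_eq_sum, ← hg, Finset.sum_filter]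
        refine Finset.sum_congr rfl fun j _ => ?_
        split_ifs
        · rfl
        · exact zero_smul ℝ (R.row j)
      · intro h0
        have := congrFun h0 i
        rw [Finset.mem_filter] at hi
        simp [hi.2, hgi] at this
      · intro j hj
        by_contra hc
        simp [hc] at hj
    rcases le_total (z ⬝ᵥ c) 0 with hc | hc
    · exact ⟨z, hzR, hc, hzne, hzsupp⟩
    · exact ⟨-z, by rw [neg_vecMul, hzR, neg_zero], by rw [neg_dotProduct]; linarith,
        neg_ne_zero.2 hzne, fun i hi => hzsupp i (by simpa using hi)⟩
  have hzk : z k = 0 := by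
    by_contra hne
    exact (hzsupp k hne).2 rfl
  by_cases hneg : ∃ i, z i < 0
  · obtain ⟨i, hi, hmini⟩ := Finset.exists_min_image (Finset.univ.filter fun i => z i < 0)
      (fun i => y i / -z i) (by simpa [Finset.filter_nonempty_iff] using hneg)
    simp only [Finset.mem_filter, Finset.mem_univ, true_and] at hi hmini
    have hl : 0 ≤ y i / -z i := div_nonneg (hy0 i) (by linarith)
    refine (hzsupp i hi.ne).1 (hsmaller (y + (y i / -z i) • z) ?_ ?_ ?_ ?_ ?_ i ?_)
    · intro j
      simp only [Pi.add_apply, Pi.smul_apply, smul_eq_mul]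
      rcases lt_or_ge (z j) 0 with hj | hj
      · have := hmini j hj
        rw [le_div_iff₀ (by linarith)] at this
        linarith
      · have := hy0 j
        positivity
    · intro h0
      exact hk (by simpa [hzk] using congrFun h0 k)
    · rw [add_vecMul, smul_vecMul, hyR, hzR, smul_zero, add_zero]
    · rw [add_dotProduct, smul_dotProduct, smul_eq_mul]
      nlinarith
    · intro j hj
      have : z j = 0 := by
        by_contra hne
        exact (hzsupp j hne).1 hj
      simp [hj, this]
    · simp only [Pi.add_apply, Pi.smul_apply, smul_eq_mul]
      field_simp [hi.ne]
      ring
  · push Not at hneg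
    refine hk (hsmaller z hneg hzne hzR hzc (fun j hj => ?_) k hzk)
    by_contra hne
    exact (hzsupp j hne).1 hj

theorem exists_det_ne_zero_of_linearIndepOn {ι : Type*} [Finite ι] {n : ℕ}
    (R : Matrix ι (Fin n) ℝ) {s t : Set ι} (hs : LinearIndepOn ℝ R.row s) (hst : s ⊆ t)
    (ht : ∀ v : Fin n → ℝ, (∀ i ∈ t, (R *ᵥ v) i = 0) → v = 0) :
    ∃ f : Fin n → ι, Function.Injective f ∧ s ⊆ Set.range f ∧ Set.range f ⊆ t ∧
      (R.submatrix f id).det ≠ 0 := by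
  classical
  obtain ⟨b, hbt, hsb, hspan, hb⟩ := exists_linearIndepOn_extension hs hst
  have htop : Submodule.span ℝ (R.row '' b) = ⊤ := by
    by_contra hne
    obtain ⟨g, hg0, hg⟩ := Submodule.exists_le_ker_of_lt_top _ (lt_top_iff_ne_top.2 hne)
    have hgv := LinearMap.apply_eq_dotProduct_single g
    refine hg0 (LinearMap.ext fun w => ?_)
    rw [hgv, ht (fun j => g (Pi.single j 1)) fun i hi => ?_]
    · simp
    · exact (hgv (R i)).symm.trans (hg (hspan ⟨i, hi, rfl⟩))
  let B : Module.Basis b ℝ (Fin n → ℝ) := Module.Basis.mk (v := fun i : b => R.row i) hb (by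
    rw [← Set.image_eq_range]; exact htop.ge)
  have hcard : Nat.card b = n := by
    rw [← Module.finrank_eq_nat_card_basis B, Module.finrank_fin_fun]
  let e : Fin n ≃ b := (finCongr hcard.symm).trans (Finite.equivFin b).symm
  refine ⟨fun i => e i, Subtype.val_injective.comp e.injective, ?_, ?_, ?_⟩
  · intro i hi
    exact ⟨e.symm ⟨i, hsb hi⟩, by simp⟩
  · rintro _ ⟨i, rfl⟩
    exact hbt (e i).2
  · have hli : LinearIndependent ℝ (R.submatrix (fun i => (e i : ι)) id).row :=
      hb.comp e e.injective
    rw [linearIndependent_rows_iff_isUnit, isUnit_iff_isUnit_det] at hli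
    exact hli.ne_zero

theorem det_submatrix_map_intCast {m n : ℕ} (A : Matrix (Fin m) (Fin n) ℤ) (f : Fin n → Fin m) :
    ((A.map (Int.cast : ℤ → ℝ)).submatrix f id).det = ((A.submatrix f id).det : ℝ) :=
  ((Int.castRingHom ℝ).map_det (A.submatrix f id)).symm

theorem natAbs_det_submatrix_le_maxDet {m n : ℕ} (A : Matrix (Fin m) (Fin n) ℤ)
    (f : Fin n → Fin m) : (A.submatrix f id).det.natAbs ≤ maxDet A := by
  by_cases hf : Function.Injective f
  · exact Finset.le_sup (f := fun f => ((A.submatrix f id).det).natAbs)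
      (Finset.mem_filter.2 ⟨Finset.mem_univ f, hf⟩)
  · obtain ⟨i, j, hij, hne⟩ := by simpa [Function.Injective] using hf
    rw [det_zero_of_row_eq hne (by ext; simp [hij])]
    exact Nat.zero_le _

theorem natAbs_det_submatrix_mem_detVals {m n : ℕ} {A : Matrix (Fin m) (Fin n) ℤ}
    {f : Fin n → Fin m} (hf : Function.Injective f) (h0 : (A.submatrix f id).det ≠ 0) :
    (A.submatrix f id).det.natAbs ∈ detVals A :=
  Finset.mem_erase.2 ⟨Int.natAbs_ne_zero.2 h0, Finset.mem_image_of_mem _ (by simpa using hf)⟩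

theorem lcmDet_pos {m n : ℕ} (A : Matrix (Fin m) (Fin n) ℤ) : 0 < lcmDet A := by
  rw [Nat.pos_iff_ne_zero, lcmDet, Ne, Finset.lcm_eq_zero_iff]
  simp [detVals]

theorem sum_le_mul_maxDet_div_gcdDet {m n : ℕ} (A : Matrix (Fin m) (Fin n) ℤ)
    (hA : ∀ v : Fin n → ℝ, A.map (Int.cast : ℤ → ℝ) *ᵥ v = 0 → v = 0)
    {y : Fin m → ℝ} (hyA : y ᵥ* A.map (Int.cast : ℤ → ℝ) = 0) {k : Fin m} (hk : 0 < y k)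
    (hli : LinearIndepOn ℝ (A.map (Int.cast : ℤ → ℝ)).row {i | y i ≠ 0 ∧ i ≠ k}) :
    ∑ i, y i ≤ y k * ((maxDet A : ℝ) / (gcdDet A : ℝ)) * (n + 1) := by
  set R := A.map (Int.cast : ℤ → ℝ) with hR
  obtain ⟨f, hf, hsub, -, hdet⟩ := exists_det_ne_zero_of_linearIndepOn R hli
    (Set.subset_univ _) fun v hv => hA v (funext fun i => hv i trivial)
  set y' : Fin m → ℝ := fun i => if i = k then 0 else y i with hy'
  have hsum : ∀ {M : Type} [AddCommMonoid M] (g : Fin m → M), (∀ i, y' i = 0 → g i = 0) →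
      ∑ i, g i = ∑ j, g (f j) := by
    intro M _ g hg
    rw [← Finset.sum_image (s := Finset.univ) (f := g) hf.injOn]
    refine (Finset.sum_subset (Finset.subset_univ _) fun i _ hi => hg i ?_).symm
    by_contra hne
    have hik : i ≠ k := by rintro rfl; simp [hy'] at hne
    obtain ⟨j, rfl⟩ := hsub ⟨by simpa [hy', hik] using hne, hik⟩
    exact hi (Finset.mem_image_of_mem f (Finset.mem_univ j))
  have hsplit : ∀ i, y i = y' i + if i = k then y k else 0 := by
    intro i
    by_cases h : i = k <;> simp [hy', h]
  have hrow : R.row k = ∑ j, (-(y' (f j) / y k)) • (R.submatrix f id) j := by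
    have h1 : y' ᵥ* R + y k • R.row k = 0 := by
      rw [← hyA, show y = y' + Pi.single k (y k) from funext fun i => by
        rw [hsplit i]; simp [Pi.single_apply], add_vecMul]
      simp [hy', single_vecMul]
    have hv : y' ᵥ* R = ∑ j, y' (f j) • R.row (f j) :=
      (vecMul_eq_sum y' R).trans (hsum (fun i => y' i • R.row i) fun i hi => by simp [hi])
    rw [hv] at h1
    have h2 : R.row k = -(y k)⁻¹ • ∑ j, y' (f j) • R.row (f j) := by
      rw [eq_neg_of_add_eq_zero_left h1, smul_neg, neg_smul, neg_neg, smul_smul,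
        inv_mul_cancel₀ hk.ne', one_smul]
    rw [h2, Finset.smul_sum]
    refine Finset.sum_congr rfl fun j _ => ?_
    rw [smul_smul]
    congr 1
    field_simp
  have hdetZ : (A.submatrix f id).det ≠ 0 := by
    rw [det_submatrix_map_intCast] at hdet
    exact_mod_cast hdet
  have hmem := natAbs_det_submatrix_mem_detVals hf hdetZ
  have hdvd : gcdDet A ∣ (A.submatrix f id).det.natAbs := Finset.gcd_dvd hmem
  have hgle : gcdDet A ≤ (A.submatrix f id).det.natAbs :=
    Nat.le_of_dvd (Int.natAbs_pos.2 hdetZ) hdvd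
  have hgpos : 0 < gcdDet A := Nat.pos_of_dvd_of_pos hdvd (Int.natAbs_pos.2 hdetZ)
  have hgR : (0 : ℝ) < gcdDet A := by exact_mod_cast hgpos
  have habs : ∀ g : Fin n → Fin m, |(R.submatrix g id).det| = ((A.submatrix g id).det.natAbs : ℝ) :=
    fun g => by rw [hR, det_submatrix_map_intCast, Nat.cast_natAbs, Int.cast_abs]
  have hgleR : (gcdDet A : ℝ) ≤ |(R.submatrix f id).det| := by
    rw [habs]
    exact_mod_cast hgle
  have hone : 1 ≤ (maxDet A : ℝ) / gcdDet A := by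
    rw [one_le_div hgR]
    exact_mod_cast hgle.trans (natAbs_det_submatrix_le_maxDet A f)
  have hcoef : ∀ j, y' (f j) ≤ y k * ((maxDet A : ℝ) / gcdDet A) := by
    intro j
    have h1 := det_updateRow_sum (R.submatrix f id) j fun j => -(y' (f j) / y k)
    rw [← hrow] at h1
    have h2 : (R.submatrix f id).updateRow j (R.row k) =
        R.submatrix (Function.update f j k) id := by
      ext i l
      by_cases h : i = j
      · subst h; simp
      · simp [h]
    have h3 : |(R.submatrix (Function.update f j k) id).det| ≤ maxDet A := by
      rw [habs]
      exact_mod_cast natAbs_det_submatrix_le_maxDet A _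
    rw [← h2, h1, smul_eq_mul, abs_mul, abs_neg] at h3
    have h4 : y' (f j) / y k ≤ (maxDet A : ℝ) / gcdDet A := by
      rw [le_div_iff₀ hgR]
      exact (mul_le_mul (le_abs_self _) hgleR hgR.le (abs_nonneg _)).trans h3
    rwa [div_le_iff₀' hk] at h4
  calc ∑ i, y i = ∑ i, y' i + y k := by
        rw [Finset.sum_congr rfl fun i _ => hsplit i, Finset.sum_add_distrib]
        simp
    _ = ∑ j, y' (f j) + y k := by rw [hsum y' fun _ h => h]
    _ ≤ ∑ _j : Fin n, y k * ((maxDet A : ℝ) / gcdDet A) + y k * ((maxDet A : ℝ) / gcdDet A) :=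
        add_le_add (Finset.sum_le_sum fun j _ => hcoef j) (le_mul_of_one_le_right hk.le hone)
    _ = y k * ((maxDet A : ℝ) / gcdDet A) * (n + 1) := by
        simp only [Finset.sum_const, Finset.card_univ, Fintype.card_fin, nsmul_eq_mul]
        ring

theorem eq_zero_of_mulVec_eq_zero_of_isBounded_poly {m n : ℕ} {A : Matrix (Fin m) (Fin n) ℤ}
    {b : Fin m → ℤ} (hne : (poly A b).Nonempty) (hbdd : Bornology.IsBounded (poly A b))
    (v : Fin n → ℝ) (hv : A.map (Int.cast : ℤ → ℝ) *ᵥ v = 0) : v = 0 := by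
  obtain ⟨x, hx⟩ := hne
  obtain ⟨C, hC⟩ := isBounded_iff_forall_norm_le.1 hbdd
  by_contra hv0
  have hvn : 0 < ‖v‖ := norm_pos_iff.2 hv0
  have hC0 : 0 ≤ C := (norm_nonneg x).trans (hC x hx)
  have h1 : ‖x + ((C + ‖x‖ + 1) / ‖v‖) • v‖ ≤ C := hC _ fun i => by
    rw [mulVec_add, mulVec_smul, hv, smul_zero, add_zero]
    exact hx i
  have h2 := norm_sub_le (x + ((C + ‖x‖ + 1) / ‖v‖) • v) x
  rw [add_sub_cancel_left, norm_smul, Real.norm_of_nonneg (by positivity),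
    div_mul_cancel₀ _ hvn.ne'] at h2
  linarith

theorem isCompact_poly {m n : ℕ} {A : Matrix (Fin m) (Fin n) ℤ} {b : Fin m → ℤ}
    (hbdd : Bornology.IsBounded (poly A b)) : IsCompact (poly A b) := by
  refine Metric.isCompact_of_isClosed_isBounded ?_ hbdd
  rw [poly, Set.ofPred_forall]
  exact isClosed_iInter fun i => isClosed_le
    ((continuous_apply i).comp (continuous_const.matrix_mulVec continuous_id)) continuous_const

theorem convex_poly {m n : ℕ} (A : Matrix (Fin m) (Fin n) ℤ) (b : Fin m → ℤ) :
    Convex ℝ (poly A b) := by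
  intro x hx x' hx' s t hs ht hst i
  have h1 := mul_le_mul_of_nonneg_left (hx i) hs
  have h2 := mul_le_mul_of_nonneg_left (hx' i) ht
  have h3 : (b i : ℝ) = s * b i + t * b i := by rw [← add_mul, hst, one_mul]
  simp only [mulVec_add, mulVec_smul, Pi.add_apply, Pi.smul_apply, smul_eq_mul]
  linarith

theorem width_poly_le {m n : ℕ} {A : Matrix (Fin m) (Fin n) ℤ} {b : Fin m → ℤ}
    (hne : (poly A b).Nonempty) (hbdd : Bornology.IsBounded (poly A b))
    {y : Fin m → ℝ} (hy : ∀ i, 0 ≤ y i) (hyA : y ᵥ* A.map (Int.cast : ℤ → ℝ) = 0)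
    {k : Fin m} (hk : 0 < y k) (hAk : A k ≠ 0) :
    width (poly A b) ≤ (∑ i, y i * b i) / y k := by
  have hcomp : ∀ c : Fin n → ℤ,
      IsCompact ((fun x : Fin n → ℝ => ∑ i, (c i : ℝ) * x i) '' poly A b) := fun c =>
    (isCompact_poly hbdd).image (by fun_prop)
  have hlow : BddBelow {w : ℝ | ∃ c : Fin n → ℤ, c ≠ 0 ∧
      w = sSup ((fun x : Fin n → ℝ => ∑ i, (c i : ℝ) * x i) '' poly A b)
        - sInf ((fun x : Fin n → ℝ => ∑ i, (c i : ℝ) * x i) '' poly A b)} := by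
    refine ⟨0, ?_⟩
    rintro _ ⟨c, -, rfl⟩
    exact sub_nonneg.2 (Real.sInf_le_sSup _ (hcomp c).bddBelow (hcomp c).bddAbove)
  refine (csInf_le hlow ⟨A k, hAk, rfl⟩).trans ?_
  have hsup : sSup ((fun x : Fin n → ℝ => ∑ i, (A k i : ℝ) * x i) '' poly A b) ≤ b k := by
    refine csSup_le (hne.image _) ?_
    rintro _ ⟨x, hx, rfl⟩
    exact hx k
  have hinf : b k - (∑ i, y i * b i) / y k ≤
      sInf ((fun x : Fin n → ℝ => ∑ i, (A k i : ℝ) * x i) '' poly A b) := by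
    refine le_csInf (hne.image _) ?_
    rintro _ ⟨x, hx, rfl⟩
    have h1 : ∑ i, y i * (A.map (Int.cast : ℤ → ℝ) *ᵥ x) i = 0 := by
      have := dotProduct_mulVec y (A.map (Int.cast : ℤ → ℝ)) x
      rwa [hyA, zero_dotProduct] at this
    have h2 : y k * (b k - (A.map (Int.cast : ℤ → ℝ) *ᵥ x) k) ≤
        ∑ i, y i * (b i - (A.map (Int.cast : ℤ → ℝ) *ᵥ x) i) :=
      Finset.single_le_sum (f := fun i => y i * (b i - (A.map (Int.cast : ℤ → ℝ) *ᵥ x) i))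
        (fun i _ => mul_nonneg (hy i) (sub_nonneg.2 (hx i))) (Finset.mem_univ k)
    simp_rw [mul_sub, Finset.sum_sub_distrib, h1, sub_zero, ← mul_sub] at h2
    rw [← le_div_iff₀' hk] at h2
    change _ ≤ (A.map (Int.cast : ℤ → ℝ) *ᵥ x) k
    linarith
  linarith

theorem exists_mulVec_lt_sub_of_lt_width {m n : ℕ} {A : Matrix (Fin m) (Fin n) ℤ}
    {b : Fin m → ℤ} (hne : (poly A b).Nonempty) (hbdd : Bornology.IsBounded (poly A b))
    {t : ℝ} (ht : 0 ≤ t)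
    (hwidth : t * ((maxDet A : ℝ) / (gcdDet A : ℝ)) * (n + 1) < width (poly A b)) :
    ∃ x : Fin n → ℝ, ∀ i, A i ≠ 0 → (A.map (Int.cast : ℤ → ℝ) *ᵥ x) i < b i - t := by
  classical
  by_contra hcon
  obtain ⟨x₀, hx₀⟩ := id hne
  have hrow0 : ∀ i, A i = 0 → ∀ x : Fin n → ℝ, (A.map (Int.cast : ℤ → ℝ) *ᵥ x) i = 0 := by
    intro i hi x
    simp [mulVec, dotProduct, hi]
  obtain ⟨y, hy0, hyne, hyA, hyc, hli⟩ := exists_nonneg_linearIndepOn_of_not_lt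
    (A.map (Int.cast : ℤ → ℝ)) (fun i => if A i = 0 then (b i : ℝ) + 1 else b i - t) (by
      rintro ⟨x, hx⟩
      exact hcon ⟨x, fun i hi => by simpa [hi] using hx i⟩)
  obtain ⟨k, hyk, hAk⟩ : ∃ k, y k ≠ 0 ∧ A k ≠ 0 := by
    by_contra! hall
    obtain ⟨k, hk⟩ := Function.ne_iff.1 hyne
    refine hyc.not_gt (Finset.sum_pos' (fun i _ => ?_) ⟨k, Finset.mem_univ k, ?_⟩)
    · by_cases hi : y i = 0
      · simp [hi]
      · have := hx₀ i
        rw [hrow0 i (hall i hi)] at this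
        simp only [hall i hi, if_true]
        exact mul_nonneg (hy0 i) (by linarith)
    · have := hx₀ k
      rw [hrow0 k (hall k hk)] at this
      simp only [hall k hk, if_true]
      exact mul_pos (lt_of_le_of_ne (hy0 k) (Ne.symm hk)) (by linarith)
  have hk : 0 < y k := lt_of_le_of_ne (hy0 k) (Ne.symm hyk)
  have h1 := width_poly_le hne hbdd hy0 hyA hk hAk
  have h2 := sum_le_mul_maxDet_div_gcdDet A
    (eq_zero_of_mulVec_eq_zero_of_isBounded_poly hne hbdd) hyA hk (hli k hyk)
  have h3 : ∑ i, y i * b i ≤ t * ∑ i, y i := by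
    have : ∑ i, y i * (b i - t) ≤ 0 := by
      refine le_trans (Finset.sum_le_sum fun i _ => mul_le_mul_of_nonneg_left ?_ (hy0 i)) hyc
      split_ifs <;> linarith
    simp_rw [mul_sub, Finset.sum_sub_distrib, ← Finset.sum_mul] at this
    linarith
  refine hwidth.not_ge (h1.trans ?_)
  rw [div_le_iff₀ hk]
  calc _ ≤ t * ∑ i, y i := h3
    _ ≤ t * (y k * ((maxDet A : ℝ) / (gcdDet A : ℝ)) * (n + 1)) := by gcongr
    _ = _ := by ring

theorem exists_intCast_eq_of_mem_extremePoints_poly {m n : ℕ} {A : Matrix (Fin m) (Fin n) ℤ}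
    {b : Fin m → ℤ} (hb : ∀ i, (lcmDet A : ℤ) ∣ b i) {x : Fin n → ℝ} (hx : x ∈ (poly A b).extremePoints ℝ) :
    ∃ z : Fin n → ℤ, x = fun i => (z i : ℝ) := by
  set R := A.map (Int.cast : ℤ → ℝ) with hR
  have hactive : ∀ v : Fin n → ℝ, (∀ i ∈ {i | (R *ᵥ x) i = b i}, (R *ᵥ v) i = 0) → v = 0 := by
    intro v hv
    have hev : ∀ i, ∀ᶠ s : ℝ in nhds 0, (R *ᵥ (x + s • v)) i ≤ b i := by
      intro i
      simp only [mulVec_add, mulVec_smul, Pi.add_apply, Pi.smul_apply, smul_eq_mul]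
      rcases (hx.1 i).lt_or_eq with h | h
      · have hc : ContinuousAt (fun s : ℝ => (R *ᵥ x) i + s * (R *ᵥ v) i) 0 := by fun_prop
        exact (hc.eventually_lt_const (by simpa using h)).mono fun _ => le_of_lt
      · exact Filter.Eventually.of_forall fun s => by rw [hv i h, mul_zero, add_zero]; exact h.le
    obtain ⟨ε, hε, hball⟩ := Metric.eventually_nhds_iff.1 (Filter.eventually_all.2 hev)
    have h1 : x + (ε / 2) • v ∈ poly A b := hball (by
      rw [dist_zero_right, Real.norm_of_nonneg (by linarith)]; linarith)
    have h2 : x + (-(ε / 2)) • v ∈ poly A b := hball (by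
      rw [dist_zero_right, norm_neg, Real.norm_of_nonneg (by linarith)]; linarith)
    have h3 : x ∈ openSegment ℝ (x + (ε / 2) • v) (x + (-(ε / 2)) • v) :=
      ⟨1 / 2, 1 / 2, by norm_num, by norm_num, by norm_num, by module⟩
    have h4 := hx.2 h1 h2 h3
    simpa [hε.ne'] using h4
  obtain ⟨f, hf, -, hft, hdet⟩ := exists_det_ne_zero_of_linearIndepOn R
    (linearIndepOn_empty ℝ R.row) (Set.empty_subset _) hactive
  have hdetZ : (A.submatrix f id).det ≠ 0 := by
    rw [det_submatrix_map_intCast] at hdet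
    exact_mod_cast hdet
  have hdvd : (A.submatrix f id).det ∣ (lcmDet A : ℤ) := by
    rw [← Int.natAbs_dvd, Int.natCast_dvd_natCast]
    exact Finset.dvd_lcm (f := id) (natAbs_det_submatrix_mem_detVals hf hdetZ)
  choose q hq using fun i => hdvd.trans (hb i)
  refine ⟨(A.submatrix f id).adjugate *ᵥ fun j => q (f j), ?_⟩
  have hsol : R.submatrix f id *ᵥ x = R.submatrix f id *ᵥ fun i =>
      (((A.submatrix f id).adjugate *ᵥ fun j => q (f j)) i : ℝ) := by
    have h1 : A.submatrix f id *ᵥ ((A.submatrix f id).adjugate *ᵥ fun j => q (f j)) =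
        fun j => b (f j) := by
      rw [mulVec_mulVec, mul_adjugate, smul_mulVec, one_mulVec]
      ext j
      simp [hq (f j)]
    ext j
    have h2 : (R *ᵥ x) (f j) = b (f j) := hft ⟨j, rfl⟩
    have h3 := congrArg (Int.cast : ℤ → ℝ) (congrFun h1 j)
    refine h2.trans (h3.symm.trans ?_)
    simp [mulVec, dotProduct, hR]
  exact mulVec_injective_of_isUnit
    ((isUnit_iff_isUnit_det _).2 (isUnit_iff_ne_zero.2 hdet)) hsol

theorem finite_setOf_intCast_mem {n : ℕ} {P : Set (Fin n → ℝ)} (hP : Bornology.IsBounded P) :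
    {z : Fin n → ℤ | (fun i => (z i : ℝ)) ∈ P}.Finite := by
  obtain ⟨C, hC⟩ := isBounded_iff_forall_norm_le.1 hP
  refine (Set.Finite.pi' fun _ : Fin n => Set.finite_Icc (-⌈C⌉) ⌈C⌉).subset fun z hz i => ?_
  have h := abs_le.1 ((norm_le_pi_norm (fun i => (z i : ℝ)) i).trans (hC _ hz))
  have hc := Int.le_ceil C
  constructor
  · have : ((-⌈C⌉ : ℤ) : ℝ) ≤ z i := by push_cast; linarith
    exact_mod_cast this
  · exact_mod_cast h.2.trans hc

theorem succ_le_card_of_interior_convexHull_image_nonempty {n : ℕ} {α : Type*}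
    (p : α → Fin n → ℝ) (S : Finset α)
    (h : (interior (convexHull ℝ (p '' (S : Set α)))).Nonempty) : n + 1 ≤ S.card := by
  classical
  have htop := interior_convexHull_nonempty_iff_affineSpan_eq_top.1 h
  have hS : S.card ≠ 0 := by
    rintro h0
    rw [Finset.card_eq_zero.1 h0] at h
    simp at h
  obtain ⟨k, hk⟩ := Nat.exists_eq_succ_of_ne_zero hS
  have := finrank_vectorSpan_image_finset_le ℝ p S hk
  rw [Finset.coe_image, ← direction_affineSpan, htop, AffineSubspace.direction_top, finrank_top,
    Module.finrank_fin_fun] at this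
  omega

/-- If `A` has rank `n`, `P(A,b)` is a nonempty bounded polytope, and the
width of `P(A,b)` exceeds `(Δ_lcm(A) − 1)·(Δ(A)/Δ_gcd(A))·(n+1)`, then `P(A,b)` contains at
least `n + 1` integer points. -/
theorem flatness_bounded_det {m n : ℕ} (A : Matrix (Fin m) (Fin n) ℤ) (b : Fin m → ℤ)
    (hrank : A.rank = n)
    (hne : (poly A b).Nonempty)
    (hbdd : Bornology.IsBounded (poly A b))
    (hwidth : width (poly A b) >
      ((lcmDet A : ℝ) - 1) * ((maxDet A : ℝ) / (gcdDet A : ℝ)) * (n + 1)) :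
    ∃ S : Finset (Fin n → ℤ), n + 1 ≤ S.card ∧
      ∀ z ∈ S, (fun i => (z i : ℝ)) ∈ poly A b := by
  have hL : 0 < lcmDet A := lcmDet_pos A
  have hL1 : (1 : ℝ) ≤ lcmDet A := by exact_mod_cast hL
  obtain ⟨x, hx⟩ := exists_mulVec_lt_sub_of_lt_width hne hbdd (sub_nonneg.2 hL1) hwidth
  set b' : Fin m → ℤ := fun i => lcmDet A * (b i / lcmDet A) with hb'
  have hb'le : ∀ i, b' i ≤ b i := fun i => Int.mul_ediv_self_le (by exact_mod_cast hL.ne')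
  have hb'ge : ∀ i, (b i : ℝ) - (lcmDet A - 1) ≤ b' i := by
    intro i
    have h1 := Int.emod_lt_of_pos (b i) (Int.natCast_pos.2 hL)
    have h2 := Int.emod_add_mul_ediv (b i) (lcmDet A)
    have h3 : b i - (lcmDet A - 1) ≤ b' i := by
      simp only [hb']
      omega
    exact_mod_cast h3
  have hsub : poly A b' ⊆ poly A b := fun z hz i => (hz i).trans (by exact_mod_cast hb'le i)
  have hbdd' : Bornology.IsBounded (poly A b') := hbdd.subset hsub
  have hint : (interior (poly A b')).Nonempty := by
    refine ⟨x, mem_interior_iff_mem_nhds.2 ?_⟩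
    change ∀ᶠ z in nhds x, ∀ i, (A.map (Int.cast : ℤ → ℝ) *ᵥ z) i ≤ (b' i : ℝ)
    refine Filter.eventually_all.2 fun i => ?_
    by_cases hi : A i = 0
    · refine Filter.Eventually.of_forall fun z => ?_
      have hz : ∀ z : Fin n → ℝ, (A.map (Int.cast : ℤ → ℝ) *ᵥ z) i = 0 := fun z => by
        simp [mulVec, dotProduct, hi]
      obtain ⟨x₀, hx₀⟩ := hne
      have h0 := hx₀ i
      rw [hz] at h0 ⊢
      have h1 : 0 ≤ b i := by exact_mod_cast h0
      have h2 : 0 ≤ b' i := by positivity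
      exact_mod_cast h2
    · have hc : Continuous fun z : Fin n → ℝ => (A.map (Int.cast : ℤ → ℝ) *ᵥ z) i :=
        (continuous_apply i).comp (continuous_const.matrix_mulVec continuous_id)
      exact (hc.continuousAt.eventually_lt_const ((hx i hi).trans_le (hb'ge i))).mono
        fun _ => le_of_lt
  have hfin := finite_setOf_intCast_mem hbdd'
  refine ⟨hfin.toFinset, succ_le_card_of_interior_convexHull_image_nonempty
    (fun z i => (z i : ℝ)) _ ?_, fun z hz => hsub ((Set.Finite.mem_toFinset hfin).1 hz)⟩
  refine hint.mono (interior_mono ?_)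
  refine (closure_convexHull_extremePoints (isCompact_poly hbdd') (convex_poly A b')).ge.trans ?_
  refine closure_minimal (convexHull_mono fun v hv => ?_)
    (((Finset.finite_toSet _).image _).isCompact_convexHull ℝ).isClosed
  obtain ⟨z, rfl⟩ := exists_intCast_eq_of_mem_extremePoints_poly
    (fun i => Dvd.intro _ rfl) hv
  exact ⟨z, (Set.Finite.mem_toFinset hfin).2 hv.1, rfl⟩
end

section
/- Let A be an m×n integer matrix of rank n such that every n×n submatrix of A has determinant equal to ±Δ(A) or 0, and let b ∈ ℤ^m be such that P(A,b) = {x ∈ ℝ^n : Ax ≤ b} is a nonempty bounded polytope. If the width w(P(A,b)) is strictly greater than (Δ(A) − 1)·(n+1), then |P(A,b) ∩ ℤ^n| ≥ n+1. -/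
open Matrix

/-- In a finite additive group generated by a family `g`, every element is the sum of a word of
length less than the cardinality. -/
theorem exists_list_sum_lt_card {G ι : Type*} [AddCommGroup G] [Finite G] (g : ι → G)
    (hg : AddSubgroup.closure (Set.range g) = ⊤) (x : G) :
    ∃ l : List ι, l.length < Nat.card G ∧ (l.map g).sum = x := by
  classical
  have hex : ∃ k, ∃ l : List ι, l.length = k ∧ (l.map g).sum = x := by
    have hx : x ∈ AddSubmonoid.closure (Set.range g) := by
      rw [← AddSubgroup.closure_toAddSubmonoid_of_finite, hg]
      trivial
    induction hx using AddSubmonoid.closure_induction with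
    | mem y hy =>
      obtain ⟨i, rfl⟩ := hy
      exact ⟨1, [i], by simp⟩
    | zero => exact ⟨0, [], by simp⟩
    | add y z _ _ hy hz =>
      obtain ⟨k, l, -, rfl⟩ := hy
      obtain ⟨k', l', -, rfl⟩ := hz
      exact ⟨_, l ++ l', rfl, by simp⟩
  obtain ⟨l, hl, hsum⟩ := Nat.find_spec hex
  refine ⟨l, ?_, hsum⟩
  by_contra! hcard
  have : ¬ Function.Injective fun k : Fin (l.length + 1) => ((l.take k).map g).sum := by
    intro hinj
    have := Nat.card_le_card_of_injective _ hinj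
    rw [Nat.card_eq_fintype_card (α := Fin _), Fintype.card_fin] at this
    omega
  obtain ⟨a, b, hab, hlt⟩ : ∃ a b : Fin (l.length + 1),
      ((l.take a).map g).sum = ((l.take b).map g).sum ∧ a < b := by
    simp only [Function.Injective, not_forall] at this
    obtain ⟨a, b, hab, hne⟩ := this
    rcases lt_or_gt_of_ne hne with h | h
    exacts [⟨a, b, hab, h⟩, ⟨b, a, hab.symm, h⟩]
  refine Nat.find_min hex (m := (l.take a ++ l.drop b).length) ?_ ⟨_, rfl, ?_⟩
  · rw [← hl, List.length_append, List.length_take, List.length_drop]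
    have := b.2
    have : (a : ℕ) < b := hlt
    omega
  · rw [List.map_append, List.sum_append, hab, ← List.sum_append, ← List.map_append,
      List.take_append_drop, hsum]

/-- The cokernel of a nonsingular integer matrix has cardinality the absolute value of its
determinant, so signed unit vectors reach the image in fewer than that many steps. -/
theorem exists_list_mulVec_eq {n : ℕ} (B : Matrix (Fin n) (Fin n) ℤ) (hB : B.det ≠ 0)
    (ε : Fin n → ℤ) (hε : ∀ j, IsUnit (ε j)) (y : Fin n → ℤ) :
    ∃ l : List (Fin n), l.length < B.det.natAbs ∧
      ∃ z : Fin n → ℤ, B *ᵥ z = y + (l.map fun j => Pi.single j (ε j)).sum := by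
  have hinj : Function.Injective B.mulVecLin := by
    rw [← LinearMap.ker_eq_bot, LinearMap.ker_eq_bot']
    intro v hv
    by_contra hne
    exact hB (Matrix.exists_mulVec_eq_zero_iff.1 ⟨v, hne, hv⟩)
  set N := LinearMap.range B.mulVecLin with hN
  have hcard : Nat.card ((Fin n → ℤ) ⧸ N) = B.det.natAbs := by
    have h := Submodule.natAbs_det_equiv N (LinearEquiv.ofInjective B.mulVecLin hinj)
    have h2 : (N.subtype ∘ₗ ((LinearEquiv.ofInjective B.mulVecLin hinj : _ →+ N).toIntLinearMap))
        = Matrix.toLin' B := by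
      ext; rfl
    rw [← h, ← LinearMap.det_toLin' B, ← h2]
  have hfin : Finite ((Fin n → ℤ) ⧸ N) :=
    Nat.finite_of_card_ne_zero (by rw [hcard]; exact Int.natAbs_ne_zero.2 hB)
  let g : Fin n → (Fin n → ℤ) ⧸ N := fun j => N.mkQ (Pi.single j (ε j))
  have hg : AddSubgroup.closure (Set.range g) = ⊤ := by
    rw [eq_top_iff]
    rintro x -
    obtain ⟨v, rfl⟩ := N.mkQ_surjective x
    have hv : v = ∑ j, (v j * ε j) • (Pi.single j (ε j) : Fin n → ℤ) := by
      ext i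
      simp only [Finset.sum_apply, Pi.smul_apply, Pi.single_apply, smul_eq_mul, mul_ite, mul_zero,
        Finset.sum_ite_eq, Finset.mem_univ, if_true]
      rw [mul_assoc, Int.isUnit_mul_self (hε i), mul_one]
    rw [hv, map_sum]
    refine sum_mem fun j _ => ?_
    rw [map_zsmul]
    exact zsmul_mem (AddSubgroup.subset_closure (Set.mem_range_self j)) _
  obtain ⟨l, hl, hsum⟩ := exists_list_sum_lt_card g hg (N.mkQ (-y))
  refine ⟨l, hcard ▸ hl, ?_⟩
  have hmem : y + (l.map fun j => Pi.single j (ε j)).sum ∈ N := by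
    rw [← Submodule.ker_mkQ N, LinearMap.mem_ker, map_add, map_list_sum, List.map_map]
    change N.mkQ y + (l.map g).sum = 0
    rw [hsum, map_neg, add_neg_cancel]
  exact hmem

/-- Along every nonzero direction `d`, a bounded polyhedron has a constraint that increases. -/
theorem exists_mulVec_pos_of_isBounded {m n : ℕ} {M : Matrix (Fin m) (Fin n) ℝ} {b : Fin m → ℝ}
    (hbdd : Bornology.IsBounded {x | ∀ i, (M *ᵥ x) i ≤ b i}) {c : Fin n → ℝ}
    (hc : ∀ i, (M *ᵥ c) i ≤ b i) {d : Fin n → ℝ} (hd : d ≠ 0) : ∃ i, 0 < (M *ᵥ d) i := by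
  by_contra! hle
  obtain ⟨R, hR⟩ := hbdd.exists_norm_le
  have key : ∀ t : ℝ, 0 ≤ t → t * ‖d‖ ≤ R + ‖c‖ := by
    intro t ht
    have hmem : c + t • d ∈ {x | ∀ i, (M *ᵥ x) i ≤ b i} := by
      intro i
      rw [mulVec_add, mulVec_smul, Pi.add_apply, Pi.smul_apply, smul_eq_mul]
      nlinarith [hc i, hle i]
    have h1 := hR _ hmem
    have h2 := norm_sub_le (c + t • d) c
    rw [add_sub_cancel_left, norm_smul, Real.norm_of_nonneg ht] at h2
    linarith
  have hdpos : 0 < ‖d‖ := norm_pos_iff.2 hd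
  have hRc : 0 ≤ R + ‖c‖ := by simpa using key 0 le_rfl
  have := key ((R + ‖c‖ + 1) / ‖d‖) (by positivity)
  rw [div_mul_cancel₀ _ hdpos.ne'] at this
  linarith

/-- Moving from a point of a polyhedron along a direction that is orthogonal to all tight
constraints until a further constraint becomes tight. -/
theorem exists_tight_ssubset {m n : ℕ} {M : Matrix (Fin m) (Fin n) ℝ} {b : Fin m → ℝ}
    {x d : Fin n → ℝ} (hx : ∀ i, (M *ᵥ x) i ≤ b i)
    (htight : ∀ i, (M *ᵥ x) i = b i → (M *ᵥ d) i = 0) (hpos : ∃ i, 0 < (M *ᵥ d) i) :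
    ∃ t : ℝ, 0 ≤ t ∧ (∀ i, (M *ᵥ (x + t • d)) i ≤ b i) ∧
      {i | (M *ᵥ x) i = b i} ⊂ {i | (M *ᵥ (x + t • d)) i = b i} := by
  classical
  have hval : ∀ (t : ℝ) i, (M *ᵥ (x + t • d)) i = (M *ᵥ x) i + t * (M *ᵥ d) i := by
    intro t i
    rw [mulVec_add, mulVec_smul, Pi.add_apply, Pi.smul_apply, smul_eq_mul]
  let s : Finset (Fin m) := Finset.univ.filter fun i => 0 < (M *ᵥ d) i
  obtain ⟨k, hk, hmin⟩ := s.exists_min_image (fun i => (b i - (M *ᵥ x) i) / (M *ᵥ d) i)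
    (by obtain ⟨i, hi⟩ := hpos; exact ⟨i, by simpa [s] using hi⟩)
  have hkpos : 0 < (M *ᵥ d) k := by simpa [s] using hk
  have ht : 0 ≤ (b k - (M *ᵥ x) k) / (M *ᵥ d) k := div_nonneg (sub_nonneg.2 (hx k)) hkpos.le
  refine ⟨(b k - (M *ᵥ x) k) / (M *ᵥ d) k, ht, fun i => ?_, ?_⟩
  · rw [hval]
    rcases le_or_gt ((M *ᵥ d) i) 0 with hi | hi
    · nlinarith [hx i]
    · have := (le_div_iff₀ hi).1 (hmin i (by simpa [s] using hi))
      linarith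
  · refine Set.ssubset_iff_exists.2 ⟨fun i hi => ?_, k, ?_, fun hk' => ?_⟩
    · have hi' : (M *ᵥ x) i = b i := hi
      change _ = _
      rw [hval, htight i hi, hi', mul_zero, add_zero]
    · change _ = _
      rw [hval, div_mul_cancel₀ _ hkpos.ne', add_sub_cancel]
    · exact hkpos.ne' (htight k hk')

/-- A spanning subfamily of the rows of a matrix contains a nonsingular square submatrix. -/
theorem exists_det_ne_zero_of_span_eq_top {m n : ℕ} (M : Matrix (Fin m) (Fin n) ℝ)
    (T : Set (Fin m)) (hT : Submodule.span ℝ (M '' T) = ⊤) :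
    ∃ f : Fin n → Fin m, Function.Injective f ∧ (M.submatrix f id).det ≠ 0 ∧ ∀ j, f j ∈ T := by
  obtain ⟨κ, a, ha, hspan, hli⟩ := exists_linearIndependent' ℝ fun i : T => M i
  have hrange : Set.range (fun i : T => M i) = M '' T :=
    (Set.image_eq_range M T).symm
  rw [hrange, hT] at hspan
  let bas := Module.Basis.mk hli hspan.ge
  have : Finite κ := Finite.of_injective a ha
  have : Fintype κ := Fintype.ofFinite κ
  have hcard : Fintype.card κ = n := by
    rw [← Module.finrank_eq_card_basis bas, Module.finrank_fin_fun]
  let e : Fin n ≃ κ := (Fintype.equivFinOfCardEq hcard).symm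
  refine ⟨fun j => a (e j), fun i j hij => e.injective (ha (Subtype.ext hij)), ?_,
    fun j => (a (e j)).2⟩
  have hli' : LinearIndependent ℝ (M.submatrix (fun j => (a (e j) : Fin m)) id).row :=
    hli.comp e e.injective
  exact ((isUnit_iff_isUnit_det _).1 (linearIndependent_rows_iff_isUnit.1 hli')).ne_zero

/-- Over a bounded polyhedron, every value of a linear functional is at most its value at some
basic feasible point. -/
theorem exists_basic_feasible_ge {m n : ℕ} {M : Matrix (Fin m) (Fin n) ℝ} {b : Fin m → ℝ}
    (hbdd : Bornology.IsBounded {x | ∀ i, (M *ᵥ x) i ≤ b i}) (h : Fin n → ℝ) {c : Fin n → ℝ}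
    (hc : ∀ i, (M *ᵥ c) i ≤ b i) :
    ∃ x, (∀ i, (M *ᵥ x) i ≤ b i) ∧ h ⬝ᵥ c ≤ h ⬝ᵥ x ∧ ∃ f : Fin n → Fin m,
      Function.Injective f ∧ (M.submatrix f id).det ≠ 0 ∧ ∀ j, (M *ᵥ x) (f j) = b (f j) := by
  let tight : (Fin n → ℝ) → Set (Fin m) := fun x => {i | (M *ᵥ x) i = b i}
  let s : Set (Set (Fin m)) :=
    tight '' {x | (∀ i, (M *ᵥ x) i ≤ b i) ∧ h ⬝ᵥ c ≤ h ⬝ᵥ x}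
  obtain ⟨T, hT⟩ := s.toFinite.exists_maximal ⟨_, c, ⟨hc, le_rfl⟩, rfl⟩
  obtain ⟨⟨x, ⟨hx, hcx⟩, rfl⟩, hmax⟩ := hT
  refine ⟨x, hx, hcx, ?_⟩
  refine exists_det_ne_zero_of_span_eq_top M (tight x) ?_
  by_contra hspan
  obtain ⟨φ, hφ, hker⟩ := Submodule.exists_le_ker_of_lt_top _ (lt_top_iff_ne_top.2 hspan)
  obtain ⟨d, hd⟩ : ∃ d : Fin n → ℝ, ∀ v, φ v = v ⬝ᵥ d :=
    ⟨fun j => φ (Pi.single j 1), fun v => by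
      rw [LinearMap.pi_apply_eq_sum_univ φ v]
      refine Finset.sum_congr rfl fun j _ => ?_
      rw [smul_eq_mul]
      congr 2
      ext k
      simp [Pi.single_apply, eq_comm]⟩
  have hd0 : d ≠ 0 := by
    rintro rfl
    exact hφ (LinearMap.ext fun v => by simp [hd])
  have htight : ∀ i, (M *ᵥ x) i = b i → (M *ᵥ d) i = 0 := fun i hi => by
    have : φ (M i) = 0 := hker (Submodule.subset_span ⟨i, hi, rfl⟩)
    rwa [hd] at this
  obtain ⟨d', hd', htight', hhd⟩ : ∃ d' : Fin n → ℝ, d' ≠ 0 ∧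
      (∀ i, (M *ᵥ x) i = b i → (M *ᵥ d') i = 0) ∧ 0 ≤ h ⬝ᵥ d' := by
    rcases le_total 0 (h ⬝ᵥ d) with hh | hh
    · exact ⟨d, hd0, htight, hh⟩
    · refine ⟨-d, neg_ne_zero.2 hd0, fun i hi => ?_, ?_⟩
      · rw [mulVec_neg, Pi.neg_apply, htight i hi, neg_zero]
      · rw [dotProduct_neg]
        linarith
  obtain ⟨t, ht, hfeas, hss⟩ := exists_tight_ssubset hx htight'
    (exists_mulVec_pos_of_isBounded hbdd hc hd')
  refine hss.not_subset (hmax ⟨x + t • d', ⟨hfeas, ?_⟩, rfl⟩ hss.subset)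
  rw [dotProduct_add, dotProduct_smul, smul_eq_mul]
  nlinarith [mul_nonneg ht hhd]

/-- Cramer's rule for a row vector. -/
theorem vecMul_adjugate_apply {n : ℕ} (B : Matrix (Fin n) (Fin n) ℤ) (v : Fin n → ℤ) (j : Fin n) :
    (v ᵥ* B.adjugate) j = (B.updateRow j v).det := by
  rw [← cramer_transpose_apply, cramer_eq_adjugate_mulVec, ← adjugate_transpose, mulVec_transpose]

/-- If all maximal minors lie in `{0, ±Δ}`, so do the minors obtained by exchanging one row. -/
theorem natAbs_row_vecMul_adjugate_le {m n : ℕ} {A : Matrix (Fin m) (Fin n) ℤ} {Δ : ℕ}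
    (hdets : ∀ f : Fin n → Fin m, Function.Injective f → (A.submatrix f id).det.natAbs ≤ Δ)
    (f : Fin n → Fin m) (i : Fin m) (j : Fin n) :
    ((A i ᵥ* (A.submatrix f id).adjugate) j).natAbs ≤ Δ := by
  have hrow : (A.submatrix f id).updateRow j (A i) = A.submatrix (Function.update f j i) id := by
    ext k l
    rcases eq_or_ne k j with rfl | hk <;> simp [*]
  rw [vecMul_adjugate_apply, hrow]
  by_cases hinj : Function.Injective (Function.update f j i)
  · exact hdets _ hinj
  · simp only [Function.Injective, not_forall] at hinj
    obtain ⟨k, l, hkl, hne⟩ := hinj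
    rw [det_zero_of_row_eq hne (by ext; simp [hkl])]
    simp

/-- If `f` indexes a basis whose determinant `±Δ` is maximal among the maximal minors, then near the
basic solution `x` of `f` there is an integer point that exceeds `x` by at most `Δ - 1` at every
constraint and is at least as good as `x` for a given linear functional. -/
theorem exists_int_point_near_basic {m n : ℕ} {A : Matrix (Fin m) (Fin n) ℤ} {Δ : ℕ}
    (hdets : ∀ f : Fin n → Fin m, Function.Injective f → (A.submatrix f id).det.natAbs ≤ Δ)
    (f : Fin n → Fin m) (hf : (A.submatrix f id).det.natAbs = Δ) (hΔ : Δ ≠ 0)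
    (y : Fin n → ℤ) (x h : Fin n → ℝ)
    (hx : ∀ j, (A.map (Int.cast : ℤ → ℝ) *ᵥ x) (f j) = y j) :
    ∃ z : Fin n → ℤ, h ⬝ᵥ x ≤ h ⬝ᵥ (fun i => (z i : ℝ)) ∧
      ∀ i, (A.map (Int.cast : ℤ → ℝ) *ᵥ (fun i => (z i : ℝ))) i
        ≤ (A.map (Int.cast : ℤ → ℝ) *ᵥ x) i + ((Δ : ℝ) - 1) := by
  set B := A.submatrix f id with hBdef
  have hB : B.det ≠ 0 := by rwa [← Int.natAbs_ne_zero, hf]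
  set D : ℝ := (B.det : ℝ) with hD
  have hD0 : D ≠ 0 := Int.cast_ne_zero.2 hB
  have hDabs : |D| = Δ := by rw [hD, ← hf, Nat.cast_natAbs, Int.cast_abs]
  let adj : Matrix (Fin n) (Fin n) ℝ := B.adjugate.map (Int.cast : ℤ → ℝ)
  let BR : Matrix (Fin n) (Fin n) ℝ := B.map (Int.cast : ℤ → ℝ)
  have hadj : adj * BR = D • 1 := by
    have := congrArg (fun M : Matrix (Fin n) (Fin n) ℤ => M.map (Int.castRingHom ℝ))
      (adjugate_mul B)
    simp only [Matrix.map_mul] at this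
    refine this.trans ?_
    ext i j
    simp only [Matrix.map_apply, Matrix.smul_apply, Matrix.one_apply]
    split_ifs <;> simp [hD]
  let ε : Fin n → ℤ := fun j => if 0 ≤ D * (h ᵥ* adj) j then 1 else -1
  have hε : ∀ j, IsUnit (ε j) := fun j => by
    by_cases hj : 0 ≤ D * (h ᵥ* adj) j <;> simp [ε, hj]
  obtain ⟨l, hl, z, hz⟩ := exists_list_mulVec_eq B hB ε hε y
  set e : Fin n → ℤ := (l.map fun j => Pi.single j (ε j)).sum with he
  let zR : Fin n → ℝ := fun i => (z i : ℝ)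
  have hdiff : BR *ᵥ (zR - x) = fun j => (e j : ℝ) := by
    ext j
    have h1 : (BR *ᵥ x) j = y j := hx j
    have h2 : (BR *ᵥ zR) j = ((B *ᵥ z) j : ℤ) := by
      simp [BR, zR, mulVec, dotProduct]
    rw [mulVec_sub, Pi.sub_apply, h1, h2, hz]
    simp
  have hfun : ∀ v : Fin n → ℝ,
      D * (v ⬝ᵥ zR - v ⬝ᵥ x) = (l.map fun j => (v ᵥ* adj) j * (ε j : ℝ)).sum := by
    intro v
    have h1 : D • (zR - x) = adj *ᵥ fun j => (e j : ℝ) := by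
      rw [← hdiff, mulVec_mulVec, hadj, smul_mulVec, one_mulVec]
    rw [← dotProduct_sub, ← smul_eq_mul, ← dotProduct_smul, h1, dotProduct_mulVec, he]
    clear_value e
    clear hl hz he h1 hdiff
    induction l with
    | nil => simp [dotProduct]
    | cons j l ih =>
      rw [List.map_cons, List.sum_cons, List.map_cons, List.sum_cons, ← ih]
      simp only [dotProduct, Pi.add_apply, Int.cast_add, mul_add, Finset.sum_add_distrib]
      congr 1
      simp [Pi.single_apply]
  refine ⟨z, ?_, fun i => ?_⟩
  · have h1 : 0 ≤ D * (D * (h ⬝ᵥ zR - h ⬝ᵥ x)) := by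
      rw [hfun, ← List.sum_map_mul_left]
      refine List.sum_nonneg fun a ha => ?_
      obtain ⟨j, -, rfl⟩ := List.mem_map.1 ha
      by_cases hj : 0 ≤ D * (h ᵥ* adj) j
      · simp [ε, hj]
      · simp only [ε, hj, if_false]
        push_cast
        linarith
    rw [← mul_assoc] at h1
    have h2 := nonneg_of_mul_nonneg_right h1 (mul_self_pos.2 hD0)
    change h ⬝ᵥ x ≤ h ⬝ᵥ zR
    linarith
  · let v : Fin n → ℝ := A.map (Int.cast : ℤ → ℝ) i
    change v ⬝ᵥ zR ≤ v ⬝ᵥ x + (Δ - 1)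
    have hle : ∀ j, |(v ᵥ* adj) j * (ε j : ℝ)| ≤ Δ := by
      intro j
      have h1 : (v ᵥ* adj) j = ((A i ᵥ* B.adjugate) j : ℤ) := by
        simp [v, adj, vecMul, dotProduct]
      have h2 : |(ε j : ℝ)| = 1 := by
        by_cases hj : 0 ≤ D * (h ᵥ* adj) j <;> simp [ε, hj]
      rw [abs_mul, h2, mul_one, h1, ← Int.cast_abs, ← Nat.cast_natAbs]
      exact_mod_cast natAbs_row_vecMul_adjugate_le hdets f i j
    have habs : |D * (v ⬝ᵥ zR - v ⬝ᵥ x)| ≤ l.length * Δ := by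
      rw [hfun]
      clear hl hz he hfun
      clear_value e
      induction l with
      | nil => simp
      | cons j l ih =>
        rw [List.map_cons, List.sum_cons, List.length_cons]
        push_cast
        linarith [abs_add_le ((v ᵥ* adj) j * (ε j : ℝ))
          (l.map fun j => (v ᵥ* adj) j * (ε j : ℝ)).sum, hle j]
    have hΔpos : (0 : ℝ) < Δ := by exact_mod_cast Nat.pos_of_ne_zero hΔ
    rw [abs_mul, hDabs, mul_comm] at habs
    have h1 := (le_abs_self _).trans (le_of_mul_le_mul_right habs hΔpos)
    have h2 : (l.length : ℝ) + 1 ≤ Δ := by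
      rw [← hf]
      exact_mod_cast hl
    linarith

/-- A set of at most `n` points in `ℝ^n` lies in a hyperplane. -/
theorem exists_hyperplane {n : ℕ} (hn : n ≠ 0) (S : Finset (Fin n → ℤ)) (hS : S.card ≤ n) :
    ∃ (h : Fin n → ℝ) (β : ℝ), h ≠ 0 ∧ ∀ z ∈ S, h ⬝ᵥ (fun i => (z i : ℝ)) = β := by
  rcases S.eq_empty_or_nonempty with rfl | ⟨z₀, hz₀⟩
  · have : NeZero n := ⟨hn⟩
    exact ⟨1, 0, one_ne_zero, by simp⟩
  let φ : (Fin n → ℝ) →ₗ[ℝ] (S.erase z₀ → ℝ) :=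
    LinearMap.pi fun z => dotProductBilin ℝ ℝ (fun i => (z.1 i : ℝ) - z₀ i)
  have hker : LinearMap.ker φ ≠ ⊥ := by
    refine φ.ker_ne_bot_of_finrank_lt ?_
    rw [Module.finrank_fintype_fun_eq_card, Module.finrank_fin_fun, Fintype.card_coe,
      Finset.card_erase_of_mem hz₀]
    omega
  obtain ⟨h, hh, hne⟩ := (Submodule.ne_bot_iff _).1 hker
  refine ⟨h, h ⬝ᵥ (fun i => (z₀ i : ℝ)), hne, fun z hz => ?_⟩
  rcases eq_or_ne z z₀ with rfl | hzz
  · rfl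
  · have h1 : (fun i => (z i : ℝ) - z₀ i) ⬝ᵥ h = 0 :=
      congrFun (LinearMap.mem_ker.1 hh) ⟨z, Finset.mem_erase.2 ⟨hzz, hz⟩⟩
    have h2 : (fun i => (z i : ℝ) - z₀ i) = (fun i => (z i : ℝ)) - fun i => (z₀ i : ℝ) := rfl
    rwa [h2, dotProduct_comm, dotProduct_sub, sub_eq_zero] at h1

/-- If each constraint of a polyhedron in a finite family `I` has a feasible point of slack more than
`δ (n + 1)`, then some feasible point has slack more than `δ` for all of them. -/
theorem exists_forall_slack_lt {m n : ℕ} {M : Matrix (Fin m) (Fin n) ℝ} {b : Fin m → ℝ} {δ : ℝ}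
    (hne : ∃ x, ∀ i, (M *ᵥ x) i ≤ b i) (I : Finset (Fin m))
    (hI : ∀ i ∈ I, ∃ x, (∀ k, (M *ᵥ x) k ≤ b k) ∧ (M *ᵥ x) i < b i - δ * (n + 1)) :
    ∃ x, (∀ i, (M *ᵥ x) i ≤ b i) ∧ ∀ i ∈ I, (M *ᵥ x) i < b i - δ := by
  classical
  obtain ⟨x₀, hx₀⟩ := hne
  have hrow : ∀ i, IsLinearMap ℝ fun x : Fin n → ℝ => (M *ᵥ x) i := fun i =>
    ⟨fun x y => by rw [mulVec_add, Pi.add_apply], fun c x => by rw [mulVec_smul, Pi.smul_apply]⟩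
  have hconv : Convex ℝ {x : Fin n → ℝ | ∀ i, (M *ᵥ x) i ≤ b i} := by
    rw [Set.ofPred_forall]
    exact convex_iInter fun i => convex_halfSpace_le (hrow i) _
  rcases I.eq_empty_or_nonempty with rfl | ⟨i₀, hi₀⟩
  · exact ⟨x₀, hx₀, by simp⟩
  let F : Fin m → Set (Fin n → ℝ) := fun i =>
    {x | ∀ i, (M *ᵥ x) i ≤ b i} ∩ {x | (M *ᵥ x) i < b i - δ}
  have := Convex.helly_theorem' (𝕜 := ℝ) (F := F) (s := I)
    (fun i _ => hconv.inter (convex_halfSpace_lt (hrow i) _)) ?_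
  · obtain ⟨x, hx⟩ := this
    simp only [Set.mem_iInter] at hx
    exact ⟨x, (hx i₀ hi₀).1, fun i hi => (hx i hi).2⟩
  intro J hJI hJ
  rw [Module.finrank_fin_fun] at hJ
  choose! p hp hp' using hI
  let N : ℝ := n + 1
  have hN : 0 < N := by positivity
  have hJN : (J.card : ℝ) ≤ N := by
    change (J.card : ℝ) ≤ (n : ℝ) + 1
    exact_mod_cast hJ
  refine ⟨N⁻¹ • (∑ k ∈ J, p k + (N - J.card) • x₀), ?_⟩
  have hval : ∀ i, (M *ᵥ (N⁻¹ • (∑ k ∈ J, p k + (N - J.card) • x₀))) i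
      = N⁻¹ * (∑ k ∈ J, (M *ᵥ p k) i + (N - J.card) * (M *ᵥ x₀) i) := by
    intro i
    simp only [mulVec_smul, mulVec_add, mulVec_sum, Pi.smul_apply, Pi.add_apply, smul_eq_mul,
      Finset.sum_apply]
  have hrest : ∀ i, (N - J.card) * (M *ᵥ x₀) i ≤ (N - J.card) * b i := fun i =>
    mul_le_mul_of_nonneg_left (hx₀ i) (sub_nonneg.2 hJN)
  simp only [Set.mem_iInter]
  refine fun i hi => ⟨fun k => ?_, ?_⟩
  · have h1 : ∑ l ∈ J, (M *ᵥ p l) k ≤ J.card * b k := by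
      rw [← nsmul_eq_mul]
      exact Finset.sum_le_card_nsmul _ _ _ fun l hl => hp l (hJI hl) k
    rw [hval, inv_mul_le_iff₀ hN]
    linarith [hrest k]
  · have h1 : ∑ l ∈ J.erase i, (M *ᵥ p l) i ≤ (J.erase i).card * b i := by
      rw [← nsmul_eq_mul]
      exact Finset.sum_le_card_nsmul _ _ _ fun l hl => hp l (hJI (Finset.mem_of_mem_erase hl)) i
    rw [Finset.card_erase_of_mem hi, Nat.cast_pred (Finset.card_pos.2 ⟨i, hi⟩)] at h1
    have h2 := hp' i (hJI hi)
    rw [Set.mem_ofPred_eq, hval, inv_mul_lt_iff₀ hN, ← Finset.add_sum_erase _ _ hi]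
    have h3 : N * (b i - δ) = N * b i - δ * (n + 1) := by
      change (n + 1 : ℝ) * _ = (n + 1 : ℝ) * _ - _
      ring
    linarith [hrest i]

/-- The width of a nonempty bounded set is at most its extent along any nonzero integer vector. -/
theorem width_le {n : ℕ} {P : Set (Fin n → ℝ)} (hne : P.Nonempty)
    (hbdd : Bornology.IsBounded P) {c : Fin n → ℤ} (hc : c ≠ 0) :
    width P ≤ sSup ((fun x : Fin n → ℝ => ∑ i, (c i : ℝ) * x i) '' P)
        - sInf ((fun x : Fin n → ℝ => ∑ i, (c i : ℝ) * x i) '' P) := by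
  refine csInf_le ⟨0, ?_⟩ ⟨c, hc, rfl⟩
  rintro w ⟨d, -, rfl⟩
  have hb : Bornology.IsBounded ((fun x : Fin n → ℝ => ∑ i, (d i : ℝ) * x i) '' P) :=
    ((hbdd.isCompact_closure.image (by fun_prop)).isBounded).subset
      (Set.image_mono subset_closure)
  exact sub_nonneg.2 (csInf_le_csSup (hne.image _) hb.bddBelow hb.bddAbove)

/-- Each nonzero row of a polytope wider than `w` has slack more than `w` at some point. -/
theorem exists_slack_of_lt_width {m n : ℕ} {A : Matrix (Fin m) (Fin n) ℤ} {b : Fin m → ℤ}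
    {w : ℝ} (hne : (poly A b).Nonempty) (hbdd : Bornology.IsBounded (poly A b))
    (hw : w < width (poly A b)) {i : Fin m} (hi : A i ≠ 0) :
    ∃ x ∈ poly A b, (A.map (Int.cast : ℤ → ℝ) *ᵥ x) i < b i - w := by
  have h1 := hw.trans_le (width_le hne hbdd hi)
  have h2 : sSup ((fun x : Fin n → ℝ => ∑ j, (A i j : ℝ) * x j) '' poly A b) ≤ b i := by
    refine csSup_le (hne.image _) ?_
    rintro _ ⟨x, hx, rfl⟩
    exact hx i
  obtain ⟨_, ⟨x, hx, rfl⟩, hlt⟩ := exists_lt_of_csInf_lt (hne.image _)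
    (show sInf ((fun x : Fin n → ℝ => ∑ j, (A i j : ℝ) * x j) '' poly A b) < b i - w by linarith)
  exact ⟨x, hx, hlt⟩

/-- A polytope in which all maximal minors lie in `{0, ±Δ}` and in which some point has slack more
than `Δ - 1` at each nonzero row contains integer points off any given hyperplane. -/
theorem exists_int_point_off_hyperplane {m n : ℕ} {A : Matrix (Fin m) (Fin n) ℤ} {b : Fin m → ℤ}
    {Δ : ℕ} (hdets : ∀ f : Fin n → Fin m, Function.Injective f →
      (A.submatrix f id).det = Δ ∨ (A.submatrix f id).det = -Δ ∨ (A.submatrix f id).det = 0)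
    (hbdd : Bornology.IsBounded (poly A b)) {c : Fin n → ℝ} (hc : c ∈ poly A b)
    (hslack : ∀ i, A i ≠ 0 → (A.map (Int.cast : ℤ → ℝ) *ᵥ c) i < b i - ((Δ : ℝ) - 1))
    {h : Fin n → ℝ} (hh : h ≠ 0) (β : ℝ) :
    ∃ z : Fin n → ℤ, (fun i => (z i : ℝ)) ∈ poly A b ∧ h ⬝ᵥ (fun i => (z i : ℝ)) ≠ β := by
  set M := A.map (Int.cast : ℤ → ℝ) with hM
  have hzero : ∀ i, A i = 0 → ∀ x : Fin n → ℝ, (M *ᵥ x) i = 0 := fun i hi x => by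
    have : M i = 0 := by
      ext j
      simp [hM, hi]
    rw [mulVec, this, zero_dotProduct]
  -- a point off the hyperplane with the same slack
  obtain ⟨c', hc', hβ⟩ : ∃ c' : Fin n → ℝ,
      (∀ i, A i ≠ 0 → (M *ᵥ c') i < b i - ((Δ : ℝ) - 1)) ∧ h ⬝ᵥ c' ≠ β := by
    by_cases hcβ : h ⬝ᵥ c = β
    · have hcont : ∀ i, Filter.Tendsto (fun t : ℝ => (M *ᵥ (c + t • h)) i)
          (nhdsWithin 0 (Set.Ioi 0)) (nhds ((M *ᵥ c) i)) := by
        intro i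
        have : Continuous fun t : ℝ => (M *ᵥ (c + t • h)) i := by
          simp only [mulVec_add, mulVec_smul, Pi.add_apply, Pi.smul_apply]
          fun_prop
        have h0 := this.tendsto 0
        rw [zero_smul, add_zero] at h0
        exact h0.mono_left nhdsWithin_le_nhds
      have hev : ∀ᶠ t : ℝ in nhdsWithin 0 (Set.Ioi 0),
          ∀ i, A i ≠ 0 → (M *ᵥ (c + t • h)) i < b i - ((Δ : ℝ) - 1) := by
        refine Filter.eventually_all.2 fun i => ?_
        by_cases hi : A i = 0
        · exact Filter.Eventually.of_forall fun t hne => absurd hi hne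
        · filter_upwards [(hcont i).eventually_lt_const (hslack i hi)] with t ht _ using ht
      obtain ⟨t, ht, ht0⟩ := (hev.and self_mem_nhdsWithin).exists
      refine ⟨c + t • h, ht, ?_⟩
      rw [dotProduct_add, dotProduct_smul, hcβ, smul_eq_mul]
      have : h ⬝ᵥ h ≠ 0 := fun h0 => hh (dotProduct_self_eq_zero.1 h0)
      have ht0' : t ≠ 0 := (show (0 : ℝ) < t from ht0).ne'
      rw [Ne, add_eq_left]
      exact mul_ne_zero ht0' this
    · exact ⟨c, hslack, hcβ⟩
  clear hslack
  wlog hlt : β < h ⬝ᵥ c' generalizing h β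
  · obtain ⟨z, hz, hzβ⟩ := this (h := -h) (neg_ne_zero.2 hh) (-β)
      (by rw [neg_dotProduct]; exact fun h0 => hβ (neg_injective h0))
      (by rw [neg_dotProduct]; exact neg_lt_neg (lt_of_le_of_ne (not_lt.1 hlt) hβ))
    exact ⟨z, hz, fun h0 => hzβ (by rw [neg_dotProduct, h0])⟩
  by_cases hΔ : Δ = 0
  · obtain ⟨x, -, -, f, hf, hdet, -⟩ := exists_basic_feasible_ge (M := M) hbdd h hc
    refine absurd ?_ hdet
    have h0 := hdets f hf
    rw [hΔ] at h0
    have h1 : (A.submatrix f id).det = 0 := by simpa using h0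
    have h2 : (M.submatrix f id).det = ((A.submatrix f id).det : ℤ) := by
      rw [Int.cast_det]; rfl
    rw [h2, h1, Int.cast_zero]
  have hΔ1 : (1 : ℝ) ≤ Δ := by exact_mod_cast Nat.one_le_iff_ne_zero.2 hΔ
  let b' : Fin m → ℤ := fun i => if A i = 0 then b i else b i - (Δ - 1)
  have hb' : ∀ i, (b' i : ℝ) ≤ b i := fun i => by
    by_cases hi : A i = 0
    · simp [b', hi]
    · simp only [b', hi, if_false]
      push_cast
      linarith
  obtain ⟨x, hx, hhx, f, hf, hdet, hxf⟩ := exists_basic_feasible_ge (M := M)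
    (b := fun i => (b' i : ℝ)) (hbdd.subset fun x hx i => (hx i).trans (hb' i)) h (c := c')
    fun i => by
      by_cases hi : A i = 0
      · simp only [b', hi, if_true]
        rw [hzero i hi, ← hzero i hi c]
        exact hc i
      · simp only [b', hi, if_false]
        push_cast
        exact (hc' i hi).le
  have hdet' : (A.submatrix f id).det ≠ 0 := fun h1 => hdet <| by
    have h2 : (M.submatrix f id).det = ((A.submatrix f id).det : ℤ) := by
      rw [Int.cast_det]; rfl
    rw [h2, h1, Int.cast_zero]
  obtain ⟨z, hhz, hz⟩ := exists_int_point_near_basic (A := A) (Δ := Δ)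
    (fun g hg => by rcases hdets g hg with h1 | h1 | h1 <;> simp [h1]) f
    (by rcases hdets f hf with h1 | h1 | h1 <;> simp_all) hΔ (fun j => b' (f j)) x h hxf
  refine ⟨z, fun i => ?_, (hlt.trans_le (hhx.trans hhz)).ne'⟩
  change (M *ᵥ _) i ≤ _
  by_cases hi : A i = 0
  · rw [hzero i hi, ← hzero i hi c]
    exact hc i
  · have h1 := hx i
    simp only [b', hi, if_false] at h1
    push_cast at h1
    exact (hz i).trans (by linarith)

/-- If every `n × n` subdeterminant of `A` (of rank `n`) equals `±Δ(A)` or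
`0`, `P(A,b)` is a nonempty bounded polytope, and the width of `P(A,b)` exceeds
`(Δ(A) − 1)·(n+1)`, then `P(A,b)` contains at least `n + 1` integer points. -/
theorem flatness_strict_delta_modular {m n : ℕ} (A : Matrix (Fin m) (Fin n) ℤ)
    (b : Fin m → ℤ)
    (hdets : ∀ f : Fin n → Fin m, Function.Injective f →
      (A.submatrix f id).det = (maxDet A : ℤ) ∨ (A.submatrix f id).det = -(maxDet A : ℤ) ∨
        (A.submatrix f id).det = 0)
    (hrank : A.rank = n)
    (hne : (poly A b).Nonempty)
    (hbdd : Bornology.IsBounded (poly A b))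
    (hwidth : width (poly A b) > ((maxDet A : ℝ) - 1) * (n + 1)) :
    ∃ S : Finset (Fin n → ℤ), n + 1 ≤ S.card ∧
      ∀ z ∈ S, (fun i => (z i : ℝ)) ∈ poly A b := by
  have hpoint : ∃ c ∈ poly A b, ∀ i, A i ≠ 0 →
      (A.map (Int.cast : ℤ → ℝ) *ᵥ c) i < b i - ((maxDet A : ℝ) - 1) := by
    classical
    obtain ⟨c, hc, hslack⟩ := exists_forall_slack_lt (b := fun i => (b i : ℝ)) hne
      (Finset.univ.filter fun i => A i ≠ 0) fun i hi =>
        exists_slack_of_lt_width hne hbdd hwidth (Finset.mem_filter.1 hi).2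
    exact ⟨c, hc, fun i hi => hslack i (by simpa using hi)⟩
  obtain ⟨c, hc, hslack⟩ := hpoint
  rcases eq_or_ne n 0 with rfl | hn
  · refine ⟨{0}, by simp, fun z _ => ?_⟩
    rwa [Subsingleton.elim (fun i => (z i : ℝ)) c]
  suffices ∀ k ≤ n + 1, ∃ S : Finset (Fin n → ℤ), S.card = k ∧
      ∀ z ∈ S, (fun i => (z i : ℝ)) ∈ poly A b by
    obtain ⟨S, hS, hSP⟩ := this (n + 1) le_rfl
    exact ⟨S, hS.ge, hSP⟩
  intro k
  induction k with
  | zero => exact fun _ => ⟨∅, by simp⟩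
  | succ k ih =>
    intro hk
    obtain ⟨S, hS, hSP⟩ := ih (by omega)
    obtain ⟨h, β, hh, hβ⟩ := exists_hyperplane hn S (by omega)
    obtain ⟨z, hz, hzβ⟩ := exists_int_point_off_hyperplane hdets hbdd hc hslack hh β
    have hzS : z ∉ S := fun hmem => hzβ (hβ z hmem)
    exact ⟨insert z S, by rw [Finset.card_insert_of_notMem hzS, hS],
      Finset.forall_mem_insert _ _ _ |>.2 ⟨hz, hSP⟩⟩
end

section
/- Let A be an m×n integer matrix of rank n, and let b', b'' ∈ ℤ^m be such that P' = P(A,b') and P'' = P(A,b'') are both nonempty bounded polytopes. Then |w(P') − w(P'')| ≤ (Δ(A)/Δ_gcd(A))·(n+1)·‖b' − b''‖_∞. -/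
open Matrix

section Polyhedral

variable {m n : ℕ} {B : Matrix (Fin m) (Fin n) ℝ}

/-- A nonempty bounded polyhedron has no nonzero recession direction. -/
lemma eq_zero_of_mulVec_nonpos {b : Fin m → ℝ}
    (hne : {x | ∀ i, (B *ᵥ x) i ≤ b i}.Nonempty)
    (hbdd : Bornology.IsBounded {x | ∀ i, (B *ᵥ x) i ≤ b i})
    {d : Fin n → ℝ} (hd : ∀ i, (B *ᵥ d) i ≤ 0) : d = 0 := by
  obtain ⟨x, hx⟩ := hne
  obtain ⟨C, hC⟩ := hbdd.exists_norm_le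
  by_contra h
  have hpos : 0 < ‖d‖ := norm_pos_iff.mpr h
  have hx0 : ‖x‖ ≤ C := hC x hx
  have hk : 0 ≤ (2 * C + 1) / ‖d‖ := by
    have := norm_nonneg x
    positivity [this.trans hx0]
  have hmem := hC (x + ((2 * C + 1) / ‖d‖) • d) (by
    intro i
    rw [mulVec_add, mulVec_smul]
    simp only [Pi.add_apply, Pi.smul_apply, smul_eq_mul]
    nlinarith [hx i, mul_nonneg hk (neg_nonneg.mpr (hd i))])
  have h1 : ‖((2 * C + 1) / ‖d‖) • d‖ = 2 * C + 1 := by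
    rw [norm_smul, Real.norm_of_nonneg hk, div_mul_cancel₀ _ hpos.ne']
  have h2 := norm_sub_le (x + ((2 * C + 1) / ‖d‖) • d) x
  rw [add_sub_cancel_left, h1] at h2
  linarith

lemma span_row_eq_top (hinj : ∀ d, B *ᵥ d = 0 → d = 0) :
    Submodule.span ℝ (Set.range B.row) = ⊤ := by
  have hli : LinearIndependent ℝ B.col := by
    rw [← mulVec_injective_iff]
    exact (injective_iff_map_eq_zero B.mulVecLin).mpr hinj
  apply Submodule.eq_top_of_finrank_eq
  rw [← rank_eq_finrank_span_row, ← rank_transpose, LinearIndependent.rank_matrix (M := Bᵀ) hli]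
  simp

/-- Approximate linear programming duality for polyhedra without recession directions. -/
lemma exists_dual_of_forall_le {b : Fin m → ℝ} {c : Fin n → ℝ} {s s' : ℝ}
    (hrec : ∀ d, (∀ i, (B *ᵥ d) i ≤ 0) → d = 0)
    (hs : ∀ x, (∀ i, (B *ᵥ x) i ≤ b i) → c ⬝ᵥ x ≤ s) (hss : s < s') :
    ∃ y, 0 ≤ y ∧ y ᵥ* B = c ∧ b ⬝ᵥ y < s' := by
  let L : ((Fin m → ℝ) × ℝ) →ₗ[ℝ] ((Fin n → ℝ) × ℝ) :=
    { toFun := fun p => (p.1 ᵥ* B, b ⬝ᵥ p.1 + p.2)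
      map_add' := fun p q => by
        ext <;> simp [add_vecMul, dotProduct_add]; ring
      map_smul' := fun k p => by
        ext <;> simp [smul_vecMul, dotProduct_smul, mul_add] }
  have hL : Function.Surjective L := by
    rintro ⟨v, r⟩
    have hv : v ∈ LinearMap.range B.vecMulLinear := by
      rw [range_vecMulLinear, span_row_eq_top fun d hd => hrec d fun i => by simp [hd]]
      trivial
    obtain ⟨y, rfl⟩ := hv
    exact ⟨(y, r - b ⬝ᵥ y), by simp [L]⟩
  let O : Set ((Fin m → ℝ) × ℝ) := (Set.univ.pi fun _ => Set.Ioi 0) ×ˢ Set.Ioi 0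
  have hOopen : IsOpen O := (isOpen_set_pi Set.finite_univ fun _ _ => isOpen_Ioi).prod isOpen_Ioi
  have hOconv : Convex ℝ O := (convex_pi fun _ _ => convex_Ioi _).prod (convex_Ioi _)
  by_cases hmem : (c, s') ∈ L '' O
  · obtain ⟨⟨y, t⟩, ⟨hy, ht⟩, hyt⟩ := hmem
    have h1 : y ᵥ* B = c := congrArg Prod.fst hyt
    have h2 : b ⬝ᵥ y + t = s' := congrArg Prod.snd hyt
    have h3 : 0 < t := ht
    exact ⟨y, fun i => (hy i trivial : 0 < y i).le, h1, by linarith⟩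
  exfalso
  obtain ⟨f, hf⟩ := geometric_hahn_banach_point_open (hOconv.linear_image L)
    (L.isOpenMap_of_finiteDimensional hL O hOopen) hmem
  have key : ∀ z : (Fin m → ℝ) × ℝ, 0 ≤ z → ∀ δ : ℝ, 0 < δ →
      f (c, s') < f (L z) + δ * f (L 1) := by
    intro z hz δ hδ
    have := hf (L (z + δ • 1)) ⟨_, ⟨fun i _ => ?_, ?_⟩, rfl⟩
    · simpa using this
    · have := hz.1 i
      simp at this ⊢
      linarith
    · have := hz.2
      simp at this ⊢
      linarith
  have hnonneg : ∀ z : (Fin m → ℝ) × ℝ, 0 ≤ z → 0 ≤ f (L z) := by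
    intro z hz
    by_contra! hneg
    obtain ⟨k, hk⟩ := exists_nat_gt ((f (L 1) - f (c, s')) / -f (L z))
    rw [div_lt_iff₀ (by linarith)] at hk
    have := key ((k : ℝ) • z) (smul_nonneg k.cast_nonneg hz) 1 one_pos
    simp at this
    linarith
  have hp : f (c, s') ≤ 0 := by
    refine le_of_forall_pos_le_add fun ε hε => ?_
    have h1 := hnonneg 1 zero_le_one
    have h2 := key 0 le_rfl (ε / (f (L 1) + 1)) (by positivity)
    have h3 : ε / (f (L 1) + 1) * f (L 1) ≤ ε := by
      rw [div_mul_eq_mul_div, div_le_iff₀ (by positivity)]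
      nlinarith
    simp at h2
    linarith
  let x : Fin n → ℝ := fun j => f (Pi.single j 1, 0)
  let τ : ℝ := f (0, 1)
  have hfx : ∀ v r, f (v, r) = v ⬝ᵥ x + τ * r := by
    intro v r
    have h1 : (v, r) = ∑ j, v j • ((Pi.single j 1 : Fin n → ℝ), (0 : ℝ)) +
        r • ((0 : Fin n → ℝ), (1 : ℝ)) := by
      ext
      · simp [Prod.fst_sum, Finset.sum_apply, Pi.single_apply]
      · simp [Prod.snd_sum]
    rw [h1, map_add, map_sum]
    simp only [map_smul, smul_eq_mul]
    rw [mul_comm r]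
    rfl
  have hτ : 0 ≤ τ := by
    have := hnonneg (0, 1) ⟨le_rfl, zero_le_one⟩
    simpa [L, τ] using this
  have hrow : ∀ i, 0 ≤ (B *ᵥ x) i + τ * b i := by
    intro i
    have := hnonneg (Pi.single i 1, 0) ⟨by simp, le_rfl⟩
    simpa [L, hfx, mulVec, Matrix.row] using this
  rw [hfx] at hp
  rcases hτ.eq_or_lt with h0 | hpos
  · have hx : -x = 0 := hrec _ fun i => by
      have := hrow i
      rw [← h0] at this
      simpa [mulVec_neg] using this
    have hx : x = 0 := neg_eq_zero.mp hx
    have := key 0 le_rfl 1 one_pos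
    have hf0 : ∀ p, f p = 0 := fun p => by
      rw [show p = (p.1, p.2) from rfl, hfx, hx, ← h0]
      simp
    simp [hf0] at this
  · have := hs (-(τ⁻¹ • x)) fun i => by
      have := hrow i
      rw [mulVec_neg, mulVec_smul]
      simp only [Pi.neg_apply, Pi.smul_apply, smul_eq_mul]
      rw [← mul_neg, inv_mul_le_iff₀ hpos]
      linarith
    rw [dotProduct_neg, dotProduct_smul, smul_eq_mul, ← mul_neg, inv_mul_le_iff₀ hpos] at this
    nlinarith

lemma exists_dual_support_of_forall_le {b : Fin m → ℝ} {c : Fin n → ℝ} {s s' : ℝ}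
    (hne : {x | ∀ i, (B *ᵥ x) i ≤ b i}.Nonempty)
    (hbdd : Bornology.IsBounded {x | ∀ i, (B *ᵥ x) i ≤ b i})
    (hs : ∀ x, (∀ i, (B *ᵥ x) i ≤ b i) → c ⬝ᵥ x ≤ s) (hss : s < s') :
    ∃ y, 0 ≤ y ∧ y ᵥ* B = c ∧ b ⬝ᵥ y < s' ∧ ∀ i, B i = 0 → y i = 0 := by
  classical
  obtain ⟨y, hy, hyc, hyb⟩ :=
    exists_dual_of_forall_le (fun _ => eq_zero_of_mulVec_nonpos hne hbdd) hs hss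
  obtain ⟨x, hx⟩ := hne
  refine ⟨fun i => if B i = 0 then 0 else y i, fun i => ?_, ?_, lt_of_le_of_lt ?_ hyb, ?_⟩
  · have := hy i
    dsimp only
    split_ifs
    exacts [le_rfl, this]
  · rw [← hyc]
    ext j
    simp only [vecMul, dotProduct]
    refine Finset.sum_congr rfl fun i _ => ?_
    split_ifs with h
    · simp [h]
    · rfl
  · refine Finset.sum_le_sum fun i _ => ?_
    dsimp only
    split_ifs with h
    · have := hx i
      simp only [mulVec, h, zero_dotProduct] at this
      simpa using mul_nonneg this (hy i)
    · exact le_rfl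
  · intro i hi
    simp [hi]

end Polyhedral

section Circuits

variable {m n : ℕ}

lemma exists_sub_smul_nonneg {w d : Fin m → ℝ} (hw : 0 ≤ w) (hd : ∀ i, w i = 0 → d i = 0)
    (hpos : ∃ i, 0 < d i) :
    ∃ r : ℝ, 0 < r ∧ 0 ≤ w - r • d ∧ ∃ i, w i ≠ 0 ∧ (w - r • d) i = 0 := by
  obtain ⟨i₀, hi₀⟩ := hpos
  obtain ⟨i, hi, hmin⟩ := Finset.exists_min_image
    (Finset.univ.filter fun i => 0 < d i) (fun i => w i / d i) ⟨i₀, by simpa using hi₀⟩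
  simp only [Finset.mem_filter, Finset.mem_univ, true_and] at hi hmin
  have hwi : w i ≠ 0 := fun h => hi.ne' (hd i h)
  have hwpos : 0 < w i := lt_of_le_of_ne (hw i) hwi.symm
  refine ⟨w i / d i, by positivity, fun j => ?_, i, hwi, ?_⟩
  · simp only [Pi.zero_apply, Pi.sub_apply, Pi.smul_apply, smul_eq_mul, sub_nonneg]
    rcases le_or_gt (d j) 0 with h | h
    · exact (mul_nonpos_of_nonneg_of_nonpos (by positivity) h).trans (hw j)
    · exact (le_div_iff₀ h).mp (hmin j h)
  · simp [hi.ne']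

lemma card_support_lt {u v : Fin m → ℝ} (h : ∀ i, u i = 0 → v i = 0)
    (hi : ∃ i, u i ≠ 0 ∧ v i = 0) :
    (Finset.univ.filter fun i => v i ≠ 0).card < (Finset.univ.filter fun i => u i ≠ 0).card := by
  obtain ⟨i, hu, hv⟩ := hi
  refine Finset.card_lt_card ((Finset.ssubset_iff_of_subset fun j => ?_).mpr ⟨i, ?_, ?_⟩)
  · simpa using mt (h j)
  · simpa using hu
  · simpa using hv

/-- Below every nonnegative left-kernel vector there is one of minimal support. -/
lemma exists_minimal_support {B : Matrix (Fin m) (Fin n) ℝ} (u : Fin m → ℝ) (hu : 0 ≤ u)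
    (huB : u ᵥ* B = 0) (hu0 : u ≠ 0) :
    ∃ w, 0 ≤ w ∧ w ᵥ* B = 0 ∧ w ≠ 0 ∧ (∀ i, u i = 0 → w i = 0) ∧
      ∀ d, d ᵥ* B = 0 → (∀ i, w i = 0 → d i = 0) → (∃ i, w i ≠ 0 ∧ d i = 0) → d = 0 := by
  induction hk : (Finset.univ.filter fun i => u i ≠ 0).card using Nat.strong_induction_on
    generalizing u with
  | _ k ih =>
  by_cases hmin : ∀ d, d ᵥ* B = 0 → (∀ i, u i = 0 → d i = 0) → (∃ i, u i ≠ 0 ∧ d i = 0) → d = 0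
  · exact ⟨u, hu, huB, hu0, fun _ => id, hmin⟩
  push Not at hmin
  obtain ⟨d, hdB, hdu, ⟨i, hui, hdi⟩, hd0⟩ := hmin
  wlog hpos : ∃ j, 0 < d j generalizing d
  · refine this (-d) (by simp [neg_vecMul, hdB]) (by simpa using hdu) (by simpa using hd0)
      (by simpa using hdi) ?_
    by_contra! h
    push Not at hpos
    exact hd0 (funext fun j => le_antisymm (hpos j) (by simpa using h j))
  obtain ⟨r, -, hr, hex⟩ := exists_sub_smul_nonneg hu hdu hpos
  have hsub : ∀ j, u j = 0 → (u - r • d) j = 0 := fun j hj => by simp [hj, hdu j hj]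
  obtain ⟨w, h1, h2, h3, h4, h5⟩ := ih _ (hk ▸ card_support_lt hsub hex) (u - r • d) hr
    (by simp [sub_vecMul, smul_vecMul, huB, hdB]) (fun h => hui (by simpa [hdi] using congrFun h i))
    rfl
  exact ⟨w, h1, h2, h3, fun j hj => h4 j (hsub j hj), h5⟩

lemma det_submatrix_le_maxDet (A : Matrix (Fin m) (Fin n) ℤ) {f : Fin n → Fin m}
    (hf : Function.Injective f) : ((A.submatrix f id).det).natAbs ≤ maxDet A :=
  Finset.le_sup (f := fun f : Fin n → Fin m => ((A.submatrix f id).det).natAbs) (by simpa using hf)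

lemma gcdDet_dvd_det (A : Matrix (Fin m) (Fin n) ℤ) {f : Fin n → Fin m}
    (hf : Function.Injective f) (h0 : (A.submatrix f id).det ≠ 0) :
    gcdDet A ∣ ((A.submatrix f id).det).natAbs :=
  Finset.gcd_dvd (f := id) (by
    simp only [detVals, Finset.mem_erase, Finset.mem_image, Finset.mem_filter, Finset.mem_univ,
      true_and]
    exact ⟨Int.natAbs_ne_zero.mpr h0, f, hf, rfl⟩)

/-- A minimal-support dependency among rows lives on a row basis together with one more row. -/
lemma exists_basis_of_minimal_support {B : Matrix (Fin m) (Fin n) ℝ}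
    (hinj : ∀ d, B *ᵥ d = 0 → d = 0) {w : Fin m → ℝ} (hwB : w ᵥ* B = 0) {s : Fin m} (hs : w s ≠ 0)
    (hmin : ∀ d, d ᵥ* B = 0 → (∀ i, w i = 0 → d i = 0) → (∃ i, w i ≠ 0 ∧ d i = 0) → d = 0) :
    ∃ f : Fin n → Fin m, Function.Injective f ∧ s ∉ Set.range f ∧
      LinearIndependent ℝ (fun j => B (f j)) ∧ ∀ i, w i ≠ 0 → i = s ∨ i ∈ Set.range f := by
  classical
  have hT : LinearIndepOn ℝ B.row ((Finset.univ.filter fun i => w i ≠ 0 ∧ i ≠ s : Finset (Fin m)) :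
      Set (Fin m)) := by
    rw [linearIndepOn_finset_iff]
    intro g hg i hi
    have := hmin (fun i => if w i ≠ 0 ∧ i ≠ s then g i else 0) (by
      rw [vecMul_eq_sum, ← hg, Finset.sum_filter]
      refine Finset.sum_congr rfl fun i _ => ?_
      split_ifs <;> simp [Matrix.row]) (by simp +contextual) ⟨s, hs, by simp⟩
    simpa [(Finset.mem_filter.mp hi).2] using congrFun this i
  obtain ⟨b, -, hTb, hspan, hb⟩ := exists_linearIndepOn_extension hT (Set.subset_univ _)
  have hsb : s ∉ b := by
    intro hsb
    have hb' : LinearIndepOn ℝ B.row (b.toFinset : Set (Fin m)) := by simpa using hb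
    rw [linearIndepOn_finset_iff] at hb'
    refine hs (hb' w ?_ s (by simpa using hsb))
    rw [← hwB, vecMul_eq_sum]
    refine Finset.sum_subset (Finset.subset_univ _) fun i _ hi => ?_
    have : w i = 0 := by
      by_contra h
      refine hi (Set.mem_toFinset.mpr ?_)
      by_cases his : i = s
      · exact his ▸ hsb
      · exact hTb (by simp [h, his])
    simp [this]
  have htop : Submodule.span ℝ (Set.range fun i : b => B.row i) = ⊤ := by
    rw [eq_top_iff, ← span_row_eq_top hinj, Submodule.span_le, ← Set.image_univ,
      show (Set.range fun i : b => B.row i) = B.row '' b by rw [Set.image_eq_range]]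
    exact hspan
  have hcard : Fintype.card b = n := by
    rw [← finrank_span_eq_card hb, htop, finrank_top, Module.finrank_fin_fun]
  let e : Fin n ≃ b := (Fintype.equivFinOfCardEq hcard).symm
  refine ⟨fun j => e j, Subtype.val_injective.comp e.injective, ?_, ?_, fun i hi => ?_⟩
  · rintro ⟨j, hj⟩
    exact hsb (hj ▸ (e j).2)
  · exact LinearIndependent.comp hb e e.injective
  · by_cases his : i = s
    · exact Or.inl his
    · exact Or.inr ⟨e.symm ⟨i, hTb (by simp [hi, his])⟩, by simp⟩

/-- Every nonzero nonnegative left-kernel vector dominates, in support, an elementary one whose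
entries are bounded by the normalised maximal minor. -/
lemma exists_bounded_circuit (A : Matrix (Fin m) (Fin n) ℤ)
    (hinj : ∀ d, A.map (Int.cast : ℤ → ℝ) *ᵥ d = 0 → d = 0) {u : Fin m → ℝ} (hu : 0 ≤ u)
    (huA : u ᵥ* A.map (Int.cast : ℤ → ℝ) = 0) (hu0 : u ≠ 0) :
    ∃ v, 0 ≤ v ∧ v ᵥ* A.map (Int.cast : ℤ → ℝ) = 0 ∧ (∀ i, u i = 0 → v i = 0) ∧
      (∃ i, 1 ≤ v i) ∧ ∑ i, v i ≤ ((maxDet A : ℝ) / (gcdDet A : ℝ)) * (n + 1) := by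
  classical
  obtain ⟨w, hw, hwB, hw0, hwu, hmin⟩ := exists_minimal_support u hu huA hu0
  obtain ⟨s, hs⟩ : ∃ s, w s ≠ 0 := by
    by_contra! h
    exact hw0 (funext h)
  have hspos : 0 < w s := lt_of_le_of_ne (hw s) hs.symm
  obtain ⟨f, hf, hsf, hli, hsupp⟩ := exists_basis_of_minimal_support hinj hwB hs hmin
  set D := A.submatrix f id with hD
  have hDdet : D.det ≠ 0 := by
    have h1 : IsUnit (D.map (Int.cast : ℤ → ℝ)) := linearIndependent_rows_iff_isUnit.mp hli
    rw [isUnit_iff_isUnit_det, isUnit_iff_ne_zero] at h1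
    intro h
    apply h1
    have := (Int.castRingHom ℝ).map_det D
    rw [h] at this
    simpa using this.symm
  have hg : 0 < gcdDet A :=
    Nat.pos_of_dvd_of_pos (gcdDet_dvd_det A hf hDdet) (Int.natAbs_pos.mpr hDdet)
  have hgR : (0 : ℝ) < gcdDet A := by exact_mod_cast hg
  have hle : ∀ h : Fin n → Fin m, Function.Injective h →
      |((A.submatrix h id).det : ℝ)| ≤ maxDet A := by
    intro h hh
    have := det_submatrix_le_maxDet A hh
    rw [← Int.cast_abs, Int.abs_eq_natAbs]
    exact_mod_cast this
  have hcramer : ∀ j, |(D.det : ℝ)| * w (f j) =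
      w s * |((A.submatrix (Function.update f j s) id).det : ℝ)| := by
    let y : Fin n → ℤ := cramer Dᵀ (A s)
    have hy : ∀ j, y j = (A.submatrix (Function.update f j s) id).det := by
      intro j
      rw [show y j = _ from cramer_transpose_apply D (A s) j]
      congr 1
      ext i k
      by_cases hij : i = j
      · subst hij; simp
      · simp [updateRow_apply, hij, hD]
    have hyD : ∀ k, ∑ j, (y j : ℝ) * A (f j) k = D.det * A s k := by
      intro k
      have h1 : ∑ j, A (f j) k * y j = D.det * A s k := by
        have := congrFun (mulVec_cramer Dᵀ (A s)) k
        rwa [det_transpose] at this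
      have h2 : ((∑ j, A (f j) k * y j : ℤ) : ℝ) = ((D.det * A s k : ℤ) : ℝ) := by rw [h1]
      rw [Int.cast_mul, Int.cast_sum] at h2
      rw [← h2]
      refine Finset.sum_congr rfl fun j _ => ?_
      rw [Int.cast_mul, mul_comm]
    have hw' : ∀ k, w s * A s k + ∑ j, w (f j) * A (f j) k = 0 := by
      intro k
      have h1 := congrFun hwB k
      simp only [vecMul, dotProduct, map_apply, Pi.zero_apply] at h1
      rw [← h1, ← Finset.sum_subset (Finset.subset_univ (insert s (Finset.univ.image f)))]
      · rw [Finset.sum_insert (by simpa using hsf), Finset.sum_image fun _ _ _ _ h => hf h]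
      · intro i _ hi
        have : w i = 0 := by
          by_contra h
          refine hi ?_
          rcases hsupp i h with rfl | ⟨j, rfl⟩ <;> simp
        simp [this]
    have hzero := Fintype.linearIndependent_iff.mp hli
      (fun j => w s * y j + D.det * w (f j)) (by
        ext k
        simp only [Finset.sum_apply, Pi.smul_apply, smul_eq_mul, map_apply, Pi.zero_apply, add_mul,
          Finset.sum_add_distrib, mul_assoc, ← Finset.mul_sum]
        rw [hyD]
        linear_combination (D.det : ℝ) * hw' k)
    intro j
    have h1 : (D.det : ℝ) * w (f j) = -(w s * y j) := by linarith [hzero j]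
    have h2 := congrArg abs h1
    rwa [abs_neg, abs_mul, abs_mul, abs_of_nonneg (hw (f j)), abs_of_pos hspos, hy] at h2
  have hbound : ∀ i, |(D.det : ℝ)| / (gcdDet A * w s) * w i ≤ maxDet A / gcdDet A := by
    intro i
    rw [div_mul_eq_mul_div, div_le_div_iff₀ (by positivity) hgR]
    have key : |(D.det : ℝ)| * w i ≤ maxDet A * w s := by
      by_cases hi : w i = 0
      · rw [hi, mul_zero]; positivity
      rcases hsupp i hi with rfl | ⟨j, rfl⟩
      · exact mul_le_mul_of_nonneg_right (hle f hf) hspos.le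
      · rw [hcramer, mul_comm]
        refine mul_le_mul_of_nonneg_right (hle _ ?_) hspos.le
        intro p q hpq
        simp only [Function.update_apply] at hpq
        split_ifs at hpq with h1 h2 h2
        · rw [h1, h2]
        · exact absurd ⟨q, hpq.symm⟩ hsf
        · exact absurd ⟨p, hpq⟩ hsf
        · exact hf hpq
    nlinarith
  refine ⟨(|(D.det : ℝ)| / (gcdDet A * w s)) • w, smul_nonneg (by positivity) hw, ?_, ?_,
    ⟨s, ?_⟩, ?_⟩
  · rw [smul_vecMul, hwB, smul_zero]
  · intro i hi
    simp [hwu i hi]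
  · have h1 : (gcdDet A : ℝ) ≤ |(D.det : ℝ)| := by
      rw [← Int.cast_abs, Int.abs_eq_natAbs]
      exact_mod_cast Nat.le_of_dvd (Int.natAbs_pos.mpr hDdet) (gcdDet_dvd_det A hf hDdet)
    rw [Pi.smul_apply, smul_eq_mul, div_mul_eq_mul_div, le_div_iff₀ (by positivity)]
    nlinarith
  · rw [← Finset.sum_subset (Finset.subset_univ (insert s (Finset.univ.image f)))]
    · refine (Finset.sum_le_card_nsmul _ _ _ fun i _ => hbound i).trans ?_
      rw [nsmul_eq_mul, mul_comm]
      refine mul_le_mul_of_nonneg_left ?_ (by positivity)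
      have h1 := Finset.card_insert_le s (Finset.univ.image f)
      have h2 := Finset.card_image_le (s := Finset.univ) (f := f)
      rw [Finset.card_univ, Fintype.card_fin] at h2
      exact_mod_cast h1.trans (Nat.succ_le_succ h2)
    · intro i _ hi
      have : w i = 0 := by
        by_contra h
        refine hi ?_
        rcases hsupp i h with rfl | ⟨j, rfl⟩ <;> simp
      simp [this]

/-- A nonnegative left-kernel vector compares, both in mass and in objective value, with a multiple
of a single bounded elementary vector. -/
lemma exists_bounded_circuit_le (A : Matrix (Fin m) (Fin n) ℤ)
    (hinj : ∀ d, A.map (Int.cast : ℤ → ℝ) *ᵥ d = 0 → d = 0) (b u : Fin m → ℝ) (hu : 0 ≤ u)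
    (huA : u ᵥ* A.map (Int.cast : ℤ → ℝ) = 0) (hu0 : u ≠ 0) :
    ∃ v, ∃ t : ℝ, 0 ≤ v ∧ v ᵥ* A.map (Int.cast : ℤ → ℝ) = 0 ∧ (∀ i, u i = 0 → v i = 0) ∧
      (∃ i, 1 ≤ v i) ∧ ∑ i, v i ≤ ((maxDet A : ℝ) / (gcdDet A : ℝ)) * (n + 1) ∧
      0 ≤ t ∧ ∑ i, u i ≤ t * (((maxDet A : ℝ) / (gcdDet A : ℝ)) * (n + 1)) ∧
      t * (b ⬝ᵥ v) ≤ b ⬝ᵥ u := by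
  induction hk : (Finset.univ.filter fun i => u i ≠ 0).card using Nat.strong_induction_on
    generalizing u with
  | _ k ih =>
  obtain ⟨v, hv, hvA, hvu, ⟨i, hi⟩, hvM⟩ := exists_bounded_circuit A hinj hu huA hu0
  obtain ⟨r, hr, hnn, hex⟩ := exists_sub_smul_nonneg hu hvu ⟨i, one_pos.trans_le hi⟩
  have hsum : ∑ j, u j = ∑ j, (u - r • v) j + r * ∑ j, v j := by
    simp [Finset.sum_sub_distrib, Finset.mul_sum]
  have hdot : b ⬝ᵥ u = b ⬝ᵥ (u - r • v) + r * (b ⬝ᵥ v) := by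
    simp [dotProduct_sub, dotProduct_smul]
  have hrv := mul_le_mul_of_nonneg_left hvM hr.le
  by_cases h0 : u - r • v = 0
  · refine ⟨v, r, hv, hvA, hvu, ⟨i, hi⟩, hvM, hr.le, ?_, ?_⟩
    · rw [hsum, h0]
      simpa using hrv
    · rw [hdot, h0]
      simp
  have hsub : ∀ j, u j = 0 → (u - r • v) j = 0 := fun j hj => by simp [hj, hvu j hj]
  obtain ⟨v', t, hv', hvA', hvu', hi', hvM', ht, hts, htb⟩ :=
    ih _ (hk ▸ card_support_lt hsub hex) (u - r • v) hnn
      (by simp [sub_vecMul, smul_vecMul, huA, hvA]) h0 rfl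
  rcases le_total (b ⬝ᵥ v) (b ⬝ᵥ v') with hle | hle
  · exact ⟨v, t + r, hv, hvA, hvu, ⟨i, hi⟩, hvM, by positivity, by linarith,
      by linarith [mul_le_mul_of_nonneg_left hle ht]⟩
  · exact ⟨v', t + r, hv', hvA', fun j hj => hvu' j (hsub j hj), hi', hvM', by positivity,
      by linarith, by linarith [mul_le_mul_of_nonneg_left hle hr.le]⟩

end Circuits

section Width

variable {m n : ℕ}

lemma dotProduct_le_of_mem_poly {A : Matrix (Fin m) (Fin n) ℤ} {b : Fin m → ℤ} {x : Fin n → ℝ}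
    (hx : x ∈ poly A b) {y : Fin m → ℝ} (hy : 0 ≤ y) :
    (y ᵥ* A.map (Int.cast : ℤ → ℝ)) ⬝ᵥ x ≤ (fun i => (b i : ℝ)) ⬝ᵥ y := by
  rw [← dotProduct_mulVec, dotProduct_comm _ y]
  exact dotProduct_le_dotProduct_of_nonneg_left hx hy

lemma isBounded_image_dotProduct {P : Set (Fin n → ℝ)} (hP : Bornology.IsBounded P)
    (c : Fin n → ℝ) : Bornology.IsBounded ((fun x => ∑ i, c i * x i) '' P) := by
  refine (hP.isCompact_closure.image (f := fun x : Fin n → ℝ => ∑ i, c i * x i)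
    (by fun_prop)).isBounded.subset (Set.image_mono subset_closure)

/-- Integral dual solutions bound the width from above. -/
lemma width_le_of_dual {A : Matrix (Fin m) (Fin n) ℤ} {b : Fin m → ℤ}
    (hne : (poly A b).Nonempty) (hbdd : Bornology.IsBounded (poly A b)) {c : Fin n → ℤ}
    (hc : c ≠ 0) {y z : Fin m → ℝ} (hy : 0 ≤ y) (hz : 0 ≤ z)
    (hyc : y ᵥ* A.map (Int.cast : ℤ → ℝ) = fun i => (c i : ℝ))
    (hyz : (y + z) ᵥ* A.map (Int.cast : ℤ → ℝ) = 0) :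
    width (poly A b) ≤ (fun i => (b i : ℝ)) ⬝ᵥ (y + z) := by
  have hzc : z ᵥ* A.map (Int.cast : ℤ → ℝ) = -fun i => (c i : ℝ) := by
    rw [add_vecMul, hyc] at hyz
    exact (neg_eq_of_add_eq_zero_right hyz).symm
  have hsup : sSup ((fun x : Fin n → ℝ => ∑ i, (c i : ℝ) * x i) '' poly A b) ≤
      (fun i => (b i : ℝ)) ⬝ᵥ y := by
    refine csSup_le (hne.image _) ?_
    rintro _ ⟨x, hx, rfl⟩
    have := dotProduct_le_of_mem_poly hx hy
    rwa [hyc] at this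
  have hinf : -((fun i => (b i : ℝ)) ⬝ᵥ z) ≤
      sInf ((fun x : Fin n → ℝ => ∑ i, (c i : ℝ) * x i) '' poly A b) := by
    refine le_csInf (hne.image _) ?_
    rintro _ ⟨x, hx, rfl⟩
    have := dotProduct_le_of_mem_poly hx hz
    rw [hzc, neg_dotProduct] at this
    exact neg_le.mp this
  have hw : width (poly A b) ≤ sSup ((fun x : Fin n → ℝ => ∑ i, (c i : ℝ) * x i) '' poly A b) -
      sInf ((fun x : Fin n → ℝ => ∑ i, (c i : ℝ) * x i) '' poly A b) := by
    refine csInf_le ⟨0, ?_⟩ ⟨c, hc, rfl⟩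
    rintro _ ⟨c', -, rfl⟩
    have := isBounded_image_dotProduct hbdd fun i => (c' i : ℝ)
    exact sub_nonneg.mpr (Real.sInf_le_sSup _ this.bddBelow this.bddAbove)
  rw [dotProduct_add]
  linarith

lemma dotProduct_le_add_norm_mul_sum (b b' u : Fin m → ℝ) (hu : 0 ≤ u) :
    b' ⬝ᵥ u ≤ b ⬝ᵥ u + ‖b' - b‖ * ∑ i, u i := by
  rw [← sub_le_iff_le_add', ← sub_dotProduct, Finset.mul_sum]
  exact Finset.sum_le_sum fun i _ => mul_le_mul_of_nonneg_right
    ((le_abs_self _).trans (norm_le_pi_norm (b' - b) i)) (hu i)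

/-- One-sided stability of the width under perturbation of the right-hand side. -/
lemma width_le_width_add {A : Matrix (Fin m) (Fin n) ℤ} {b' b'' : Fin m → ℤ}
    (hne' : (poly A b').Nonempty) (hbdd' : Bornology.IsBounded (poly A b'))
    (hne'' : (poly A b'').Nonempty) (hbdd'' : Bornology.IsBounded (poly A b'')) :
    width (poly A b') ≤ width (poly A b'') + ((maxDet A : ℝ) / (gcdDet A : ℝ)) * (n + 1) *
        ‖(fun i => (b' i : ℝ)) - (fun i => (b'' i : ℝ))‖ := by
  set M : ℝ := ((maxDet A : ℝ) / (gcdDet A : ℝ)) * (n + 1) with hM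
  set β' : Fin m → ℝ := fun i => (b' i : ℝ) with hβ'
  set β'' : Fin m → ℝ := fun i => (b'' i : ℝ) with hβ''
  have hnorm : 0 ≤ ‖β' - β''‖ := norm_nonneg _
  rcases Nat.eq_zero_or_pos n with rfl | hn
  · have hw : ∀ P : Set (Fin 0 → ℝ), width P = 0 := by
      intro P
      rw [width, ← Real.sInf_empty]
      congr 1
      ext w
      simp only [Set.mem_ofPred_eq, Set.mem_empty_iff_false, iff_false]
      rintro ⟨c, hc, -⟩
      exact hc (Subsingleton.elim _ _)
    rw [hw, hw, zero_add]
    positivity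
  have hn' : Nonempty (Fin n) := ⟨⟨0, hn⟩⟩
  rw [← sub_le_iff_le_add]
  refine le_csInf ⟨_, 1, one_ne_zero, rfl⟩ ?_
  rintro _ ⟨c, hc, rfl⟩
  rw [sub_le_iff_le_add]
  refine le_of_forall_pos_le_add fun ε hε => ?_
  set S := (fun x : Fin n → ℝ => ∑ i, (c i : ℝ) * x i) '' poly A b'' with hS
  have hSb := isBounded_image_dotProduct hbdd'' fun i => (c i : ℝ)
  obtain ⟨y, hy, hyc, hyb, hy0⟩ := exists_dual_support_of_forall_le (b := β'')
    (c := fun i => (c i : ℝ)) (s := sSup S) (s' := sSup S + ε / 2) hne'' hbdd''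
    (fun x hx => le_csSup hSb.bddAbove ⟨x, hx, rfl⟩) (by linarith)
  obtain ⟨z, hz, hzc, hzb, hz0⟩ := exists_dual_support_of_forall_le (b := β'')
    (c := -fun i => (c i : ℝ)) (s := -sInf S) (s' := -sInf S + ε / 2) hne'' hbdd''
    (fun x hx => by
      rw [neg_dotProduct]
      exact neg_le_neg (csInf_le hSb.bddBelow ⟨x, hx, rfl⟩)) (by linarith)
  have hyz : (y + z) ᵥ* A.map (Int.cast : ℤ → ℝ) = 0 := by
    rw [add_vecMul, hyc, hzc, add_neg_cancel]
  have hyz0 : y + z ≠ 0 := by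
    intro h
    have hy' : y = 0 := le_antisymm (h ▸ le_add_of_nonneg_right hz) hy
    rw [hy', zero_vecMul] at hyc
    exact hc (funext fun i => Int.cast_eq_zero.mp (congrFun hyc i).symm)
  have hb : β'' ⬝ᵥ (y + z) ≤ sSup S - sInf S + ε := by
    rw [dotProduct_add]
    linarith
  obtain ⟨v, t, hv, hvA, hvu, ⟨i, hi⟩, hvM, ht, hts, htb⟩ := exists_bounded_circuit_le A
    (fun d hd => eq_zero_of_mulVec_nonpos hne'' hbdd'' fun i => by simp [hd]) β'' (y + z)
    (add_nonneg hy hz) hyz hyz0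
  rcases le_total t 1 with ht1 | ht1
  · have h1 := width_le_of_dual hne' hbdd' hc hy hz hyc hyz
    have h2 := dotProduct_le_add_norm_mul_sum β'' β' (y + z) (add_nonneg hy hz)
    have h3 : ∑ i, (y + z) i ≤ M := hts.trans (mul_le_of_le_one_left (by positivity) ht1)
    linarith [mul_le_mul_of_nonneg_left h3 hnorm]
  · have hAi : A i ≠ 0 := by
      intro h
      have hBi : A.map (Int.cast : ℤ → ℝ) i = 0 := by
        ext k
        simp [h]
      have := hvu i (by simp [hy0 i hBi, hz0 i hBi])
      linarith
    have hsplit : (Pi.single i 1 : Fin m → ℝ) + (v - Pi.single i 1) = v := add_sub_cancel _ _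
    have hsingle : (0 : Fin m → ℝ) ≤ v - Pi.single i 1 := by
      rw [sub_nonneg]
      intro j
      rcases eq_or_ne j i with rfl | hj
      · simpa using hi
      · simpa [hj] using hv j
    have h1 := width_le_of_dual hne' hbdd' hAi (y := Pi.single i 1) (z := v - Pi.single i 1)
      (by simp) hsingle (by ext k; simp) (by rw [hsplit, hvA])
    rw [hsplit] at h1
    have h2 := dotProduct_le_add_norm_mul_sum β'' β' v hv
    have h3 : 0 ≤ β'' ⬝ᵥ v := by
      obtain ⟨x, hx⟩ := hne''
      have := dotProduct_le_of_mem_poly hx hv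
      rwa [hvA, zero_dotProduct] at this
    linarith [mul_le_mul_of_nonneg_left hvM hnorm, le_mul_of_one_le_left h3 ht1]

end Width

/-- **Lemma 3.** If `P' = P(A,b')` and `P'' = P(A,b'')` are nonempty bounded
polytopes (with `A` of rank `n`), then
`|w(P') − w(P'')| ≤ (Δ(A)/Δ_gcd(A))·(n+1)·‖b' − b''‖_∞`. -/
theorem width_perturbation {m n : ℕ} (A : Matrix (Fin m) (Fin n) ℤ) (b' b'' : Fin m → ℤ)
    (hrank : A.rank = n)
    (hne' : (poly A b').Nonempty) (hbdd' : Bornology.IsBounded (poly A b'))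
    (hne'' : (poly A b'').Nonempty) (hbdd'' : Bornology.IsBounded (poly A b'')) :
    |width (poly A b') - width (poly A b'')| ≤
      ((maxDet A : ℝ) / (gcdDet A : ℝ)) * (n + 1) *
        ‖(fun i => (b' i : ℝ)) - (fun i => (b'' i : ℝ))‖ := by
  rw [abs_sub_le_iff]
  have h1 := width_le_width_add hne' hbdd' hne'' hbdd''
  have h2 := width_le_width_add hne'' hbdd'' hne' hbdd'
  rw [norm_sub_rev] at h2
  constructor <;> linarith
end

section
/- Let A be an (n+1)×n integer matrix and b ∈ ℤ^{n+1} such that P(A,b) = {x ∈ ℝ^n : Ax ≤ b} is an n-dimensional simplex (a bounded polytope with nonempty interior and exactly n+1 vertices). If the width w(P(A,b)) is at least δ(A) − 1, then P(A,b) contains an integer point, i.e. P(A,b) ∩ ℤ^n ≠ ∅. -/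
open Matrix

theorem Matrix.card_quotient_range_mulVecLin {ι : Type*} [Fintype ι] [DecidableEq ι]
    (B : Matrix ι ι ℤ) (hB : B.det ≠ 0) :
    Nat.card ((ι → ℤ) ⧸ LinearMap.range B.mulVecLin) = B.det.natAbs := by
  have hinj : Function.Injective B.mulVecLin := by
    rw [injective_iff_map_eq_zero]
    intro v hv
    by_contra hv0
    exact hB (Matrix.exists_mulVec_eq_zero_iff.mp ⟨v, hv0, hv⟩)
  rw [← Submodule.natAbs_det_equiv _ (LinearEquiv.ofInjective B.mulVecLin hinj),
    ← LinearMap.det_toLin']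
  rfl

/-- In a finite additive commutative group, every element is a sum of fewer than `|G|` elements
of any given generating family. -/
theorem exists_sum_nsmul_eq_of_closure_eq_top {ι G : Type*} [Fintype ι] [AddCommGroup G]
    [Finite G] (g : ι → G) (hg : AddSubgroup.closure (Set.range g) = ⊤) (x : G) :
    ∃ s : ι → ℕ, ∑ i, s i < Nat.card G ∧ ∑ i, s i • g i = x := by
  classical
  have hlist : ∃ k, ∃ l : List ι, l.length = k ∧ (l.map g).sum = x := by
    have hx : x ∈ AddSubmonoid.closure (Set.range g) := by
      rw [← AddSubgroup.closure_toAddSubmonoid_of_finite, hg]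
      trivial
    obtain ⟨l, hl, rfl⟩ := AddSubmonoid.exists_list_of_mem_closure hx
    obtain ⟨l', rfl⟩ : l ∈ Set.range (List.map g) := by
      rw [Set.range_list_map]
      exact hl
    exact ⟨_, l', rfl, rfl⟩
  obtain ⟨l, hlen, hsum⟩ := Nat.find_spec hlist
  have hlt : l.length < Nat.card G := by
    by_contra! hle
    have hnot : ¬ Function.Injective
        (fun k : Fin (l.length + 1) => ((l.take k).map g).sum) := by
      intro hinj
      have := Nat.card_le_card_of_injective _ hinj
      rw [Nat.card_fin] at this
      omega
    rw [Function.not_injective_iff] at hnot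
    obtain ⟨i, j, hij, hne⟩ := hnot
    wlog hlt : i < j generalizing i j
    · exact this j i hij.symm hne.symm (lt_of_le_of_ne (not_lt.mp hlt) hne.symm)
    have hlt' : (i : ℕ) < j := hlt
    have hj := j.2
    refine Nat.find_min hlist (m := (l.take i ++ l.drop j).length) ?_ ⟨_, rfl, ?_⟩
    · rw [← hlen, List.length_append, List.length_take, List.length_drop]
      omega
    · rw [List.map_append, List.sum_append]
      rw [hij, ← List.sum_append, ← List.map_append, List.take_append_drop, hsum]
  refine ⟨fun i => l.count i, ?_, ?_⟩
  · rw [← Multiset.coe_card, ← Multiset.sum_count_eq_card (s := Finset.univ) (by simp)] at hlt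
    simpa using hlt
  · rw [← hsum, Finset.sum_list_map_count]
    symm
    apply Finset.sum_subset (Finset.subset_univ _)
    intro i _ hi
    rw [List.count_eq_zero.mpr (by simpa using hi), zero_smul]

/-- The system `B z ≤ c` with `B` a nonsingular integer matrix has an integer solution whose
total slack is less than `|det B|`. -/
theorem Matrix.exists_mulVec_eq_sub_of_det_ne_zero {ι : Type*} [Fintype ι] [DecidableEq ι]
    (B : Matrix ι ι ℤ) (hB : B.det ≠ 0) (c : ι → ℤ) :
    ∃ (z : ι → ℤ) (s : ι → ℕ), ∑ i, s i < B.det.natAbs ∧ B *ᵥ z = fun i => c i - s i := by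
  have hcard := B.card_quotient_range_mulVecLin hB
  have : Finite ((ι → ℤ) ⧸ LinearMap.range B.mulVecLin) :=
    Nat.finite_of_card_ne_zero (by rw [hcard]; exact Int.natAbs_ne_zero.mpr hB)
  set q := (LinearMap.range B.mulVecLin).mkQ
  have hsingle (w : ι → ℤ) : q w = ∑ i, w i • q (Pi.single i 1) := by
    conv_lhs => rw [pi_eq_sum_univ' w]
    simp only [map_sum, map_smul]
  obtain ⟨s, hs, hsum⟩ := exists_sum_nsmul_eq_of_closure_eq_top
    (fun i => q (Pi.single i 1)) (by
      rw [eq_top_iff]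
      rintro x -
      obtain ⟨w, rfl⟩ := Submodule.mkQ_surjective _ x
      rw [show (LinearMap.range B.mulVecLin).mkQ w = q w from rfl, hsingle]
      refine sum_mem fun i _ => zsmul_mem (AddSubgroup.subset_closure ?_) _
      exact Set.mem_range_self i) (q c)
  have hmem : (fun i => c i - (s i : ℤ)) ∈ LinearMap.range B.mulVecLin := by
    rw [← Submodule.ker_mkQ (LinearMap.range B.mulVecLin), LinearMap.mem_ker]
    change q (c - fun i => (s i : ℤ)) = 0
    rw [map_sub, ← hsum, hsingle, sub_eq_zero]
    simp
  obtain ⟨z, hz⟩ := hmem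
  exact ⟨z, s, hcard ▸ hs, hz⟩

theorem width_le_of_isBounded {n : ℕ} {P : Set (Fin n → ℝ)} (hP : Bornology.IsBounded P)
    {c : Fin n → ℤ} (hc : c ≠ 0) :
    width P ≤ sSup ((fun x : Fin n → ℝ => ∑ i, (c i : ℝ) * x i) '' P)
        - sInf ((fun x : Fin n → ℝ => ∑ i, (c i : ℝ) * x i) '' P) := by
  refine csInf_le ⟨0, ?_⟩ ⟨c, hc, rfl⟩
  rintro _ ⟨d, -, rfl⟩
  have hb : Bornology.IsBounded ((fun x : Fin n → ℝ => ∑ i, (d i : ℝ) * x i) '' P) := by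
    have hcont : Continuous fun x : Fin n → ℝ => ∑ i, (d i : ℝ) * x i := by fun_prop
    exact ((hP.isCompact_closure.image hcont).isBounded).subset
      (Set.image_mono subset_closure)
  exact sub_nonneg.mpr (Real.sInf_le_sSup _ hb.bddBelow hb.bddAbove)

/-- A nonempty bounded polyhedron has trivial recession cone. -/
theorem eq_zero_of_mulVec_nonpos_of_isBounded_poly {m n : ℕ} {A : Matrix (Fin m) (Fin n) ℤ}
    {b : Fin m → ℤ} (hbdd : Bornology.IsBounded (poly A b)) (hne : (poly A b).Nonempty)
    {u : Fin n → ℝ} (hu : ∀ i, (A.map (Int.cast : ℤ → ℝ) *ᵥ u) i ≤ 0) : u = 0 := by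
  obtain ⟨x, hx⟩ := hne
  obtain ⟨C, hC⟩ := hbdd.exists_norm_le
  have hray (k : ℝ) (hk : 0 ≤ k) : x + k • u ∈ poly A b := by
    intro i
    rw [Matrix.mulVec_add, Matrix.mulVec_smul]
    have h1 := hx i
    have h2 := mul_nonpos_of_nonneg_of_nonpos hk (hu i)
    simp only [Pi.add_apply, Pi.smul_apply, smul_eq_mul]
    linarith
  by_contra hu0
  have hpos : 0 < ‖u‖ := norm_pos_iff.mpr hu0
  have hC0 : ‖x‖ ≤ C := hC x hx
  have hk : 0 ≤ (2 * C + 1) / ‖u‖ := by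
    have := norm_nonneg x
    apply div_nonneg <;> linarith
  have h1 := hC _ (hray _ hk)
  have h2 : ‖((2 * C + 1) / ‖u‖) • u‖ = 2 * C + 1 := by
    rw [norm_smul, Real.norm_of_nonneg hk, div_mul_cancel₀ _ hpos.ne']
  have h3 := norm_le_norm_add_norm_sub' (((2 * C + 1) / ‖u‖) • u) (-x)
  rw [norm_neg, h2, sub_neg_eq_add, add_comm (_ • u)] at h3
  linarith

/-- Let `A` be an `(n+1) × n` integer matrix and `b ∈ ℤ^{n+1}` such that
`P(A,b)` is an `n`-dimensional simplex (a bounded polytope with nonempty interior and exactly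
`n+1` vertices). If `w(P(A,b)) ≥ δ(A) − 1`, then `P(A,b)` contains an integer point. -/
theorem simplex_flatness_minDet {n : ℕ} (A : Matrix (Fin (n + 1)) (Fin n) ℤ)
    (b : Fin (n + 1) → ℤ)
    (hbdd : Bornology.IsBounded (poly A b))
    (hfull : (interior (poly A b)).Nonempty)
    (hvert : (Set.extremePoints ℝ (poly A b)).ncard = n + 1)
    (hwidth : width (poly A b) ≥ (minDet A : ℝ) - 1) :
    ∃ z : Fin n → ℤ, (fun i => (z i : ℝ)) ∈ poly A b := by
  have hne : (poly A b).Nonempty := hfull.mono interior_subset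
  obtain ⟨f, hf, hdet⟩ : minDet A ∈ {d : ℕ | ∃ f : Fin n → Fin (n + 1),
      Function.Injective f ∧ ((A.submatrix f id).det).natAbs = d} :=
    Nat.sInf_mem ⟨_, Fin.succ, Fin.succ_injective n, rfl⟩
  obtain ⟨p, hp⟩ : ∃ p, ∀ i, i = p ∨ i ∈ Set.range f := by
    have hcard : (Finset.univ.image f)ᶜ.card = 1 := by
      rw [Finset.card_compl, Finset.card_image_of_injective _ hf]
      simp
    obtain ⟨p, hp⟩ := Finset.card_eq_one.mp hcard
    refine ⟨p, fun i => ?_⟩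
    by_cases hi : i ∈ Finset.univ.image f
    · right
      simpa using hi
    · left
      rwa [← Finset.mem_compl, hp, Finset.mem_singleton] at hi
  set B := A.submatrix f id with hBdef
  set R := A.map (Int.cast : ℤ → ℝ) with hR
  set M := B.map (Int.cast : ℤ → ℝ) with hM
  have hMR (x : Fin n → ℝ) (j : Fin n) : (M *ᵥ x) j = (R *ᵥ x) (f j) := rfl
  have hMdet : M.det = (B.det : ℝ) := (Int.cast_det B).symm
  have hrec (u : Fin n → ℝ) (h1 : ∀ j, (M *ᵥ u) j ≤ 0) (h2 : (R *ᵥ u) p ≤ 0) : u = 0 := by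
    refine eq_zero_of_mulVec_nonpos_of_isBounded_poly hbdd hne fun i => ?_
    rcases hp i with rfl | ⟨j, rfl⟩
    · exact h2
    · exact h1 j
  have hB : B.det ≠ 0 := by
    intro h0
    obtain ⟨u, hu, hMu⟩ := Matrix.exists_mulVec_eq_zero_iff.mpr
      (show M.det = 0 by rw [hMdet, h0, Int.cast_zero])
    rcases le_total ((R *ᵥ u) p) 0 with h | h
    · exact hu (hrec u (by simp [hMu]) h)
    · refine hu (neg_eq_zero.mp (hrec (-u) (by simp [Matrix.mulVec_neg, hMu]) ?_))
      simpa [Matrix.mulVec_neg] using h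
  have hMunit : IsUnit M.det := by
    rw [hMdet]
    exact isUnit_iff_ne_zero.mpr (by exact_mod_cast hB)
  -- the row `p` is a negative combination of the rows of `B`
  set y : Fin n → ℝ := fun j => -(R p ᵥ* M⁻¹) j with hy
  have hRp (x : Fin n → ℝ) : (R *ᵥ x) p = -∑ j, y j * (M *ᵥ x) j := by
    have h : (R p ᵥ* M⁻¹) ⬝ᵥ (M *ᵥ x) = R p ⬝ᵥ x := by
      rw [Matrix.dotProduct_mulVec, Matrix.vecMul_vecMul, Matrix.nonsing_inv_mul _ hMunit,
        Matrix.vecMul_one]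
    change R p ⬝ᵥ x = _
    rw [← h, dotProduct, ← Finset.sum_neg_distrib]
    exact Finset.sum_congr rfl fun j _ => by simp [hy]
  have hypos (j : Fin n) : 0 < y j := by
    set u : Fin n → ℝ := M⁻¹ *ᵥ Pi.single j (-1) with hu
    have hMu : M *ᵥ u = Pi.single j (-1) := by
      rw [hu, Matrix.mulVec_mulVec, Matrix.mul_nonsing_inv _ hMunit, Matrix.one_mulVec]
    have hval : (R *ᵥ u) p = y j := by
      rw [hRp, hMu, Finset.sum_eq_single j]
      · simp
      · intro i _ hi
        simp [Pi.single_eq_of_ne hi]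
      · simp
    by_contra! hle
    have hu0 := hrec u (fun i => ?_) (hval.trans_le hle)
    · rw [hu0, Matrix.mulVec_zero] at hMu
      have := congrFun hMu j
      simp at this
    · rw [hMu]
      by_cases hi : i = j
      · subst hi
        simp
      · simp [Pi.single_eq_of_ne hi]
  set t : ℝ := b p + ∑ j, y j * b (f j) with ht
  have hslack (x : Fin n → ℝ) (hx : x ∈ poly A b) (j : Fin n) :
      y j * (b (f j) - (M *ᵥ x) j) ≤ t := by
    have hnonneg (i : Fin n) : 0 ≤ y i * (b (f i) - (M *ᵥ x) i) :=
      mul_nonneg (hypos i).le (sub_nonneg.mpr (hx (f i)))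
    have hsingle := Finset.single_le_sum (fun i _ => hnonneg i) (Finset.mem_univ j)
    have hrow : (R *ᵥ x) p ≤ b p := hx p
    rw [hRp] at hrow
    simp only [mul_sub, Finset.sum_sub_distrib] at hsingle
    linarith
  have ht0 : 0 ≤ t := by
    obtain ⟨x, hx⟩ := hne
    have hnonneg : 0 ≤ ∑ j, y j * (b (f j) - (M *ᵥ x) j) := Finset.sum_nonneg fun i _ =>
      mul_nonneg (hypos i).le (sub_nonneg.mpr (hx (f i)))
    have hrow : (R *ᵥ x) p ≤ b p := hx p
    rw [hRp] at hrow
    simp only [mul_sub, Finset.sum_sub_distrib] at hnonneg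
    linarith
  have hfacet (j : Fin n) : y j * ((minDet A : ℝ) - 1) ≤ t := by
    have hrow0 : B j ≠ 0 := fun h0 => hB (Matrix.det_eq_zero_of_row_eq_zero j (congrFun h0))
    have hwle := width_le_of_isBounded hbdd hrow0
    have hsup : sSup ((fun x : Fin n → ℝ => ∑ i, (B j i : ℝ) * x i) '' poly A b) ≤ b (f j) := by
      refine csSup_le (hne.image _) ?_
      rintro _ ⟨x, hx, rfl⟩
      exact hx (f j)
    have hinf : b (f j) - t / y j ≤
        sInf ((fun x : Fin n → ℝ => ∑ i, (B j i : ℝ) * x i) '' poly A b) := by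
      refine le_csInf (hne.image _) ?_
      rintro _ ⟨x, hx, rfl⟩
      change _ ≤ (M *ᵥ x) j
      have h := hslack x hx j
      rw [mul_comm, ← le_div_iff₀ (hypos j)] at h
      linarith
    rw [mul_comm, ← le_div_iff₀ (hypos j)]
    linarith
  obtain ⟨z, s, hs, hz⟩ := B.exists_mulVec_eq_sub_of_det_ne_zero hB fun j => b (f j)
  have hMz (j : Fin n) : (M *ᵥ fun i => (z i : ℝ)) j = b (f j) - s j := by
    have h := congrFun hz j
    simp only [Matrix.mulVec, dotProduct] at h
    simp only [hM, Matrix.mulVec, dotProduct, Matrix.map_apply]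
    exact_mod_cast h
  have hsδ : (∑ j, (s j : ℝ)) ≤ (minDet A : ℝ) - 1 := by
    rw [hdet] at hs
    rw [le_sub_iff_add_le]
    exact_mod_cast hs
  have hcost : ∑ j, y j * (s j : ℝ) ≤ t := by
    rcases (Finset.sum_nonneg fun j _ => Nat.cast_nonneg (s j) :
      (0 : ℝ) ≤ ∑ j, (s j : ℝ)).eq_or_lt with h0 | hpos
    · have hs0 := (Finset.sum_eq_zero_iff_of_nonneg
        fun j _ => (Nat.cast_nonneg (s j) : (0 : ℝ) ≤ s j)).mp h0.symm
      rw [Finset.sum_eq_zero fun j hj => by rw [hs0 j hj, mul_zero]]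
      exact ht0
    · have hδ := hpos.trans_le hsδ
      refine le_of_mul_le_mul_right ?_ hδ
      calc (∑ j, y j * (s j : ℝ)) * ((minDet A : ℝ) - 1)
          = ∑ j, y j * ((minDet A : ℝ) - 1) * s j := by
            rw [Finset.sum_mul]
            exact Finset.sum_congr rfl fun j _ => by ring
        _ ≤ ∑ j, t * (s j : ℝ) := by
            gcongr with j
            exact hfacet j
        _ = t * ∑ j, (s j : ℝ) := by rw [Finset.mul_sum]
        _ ≤ t * ((minDet A : ℝ) - 1) := by gcongr
  refine ⟨z, fun i => ?_⟩
  rcases hp i with rfl | ⟨j, rfl⟩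
  · change (R *ᵥ _) i ≤ _
    rw [hRp]
    simp only [hMz, mul_sub, Finset.sum_sub_distrib]
    linarith
  · change (M *ᵥ _) j ≤ _
    rw [hMz]
    exact sub_le_self _ (Nat.cast_nonneg _)
end
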